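/- For all positive integers d, s and every Abelian group G in which every non-zero element has order greater than (s+1)!, the following holds: for every polynomial Q : {0,1}^n → G of degree at most d with at least s non-zero monomials, Pr over uniform x ∈ {0,1}^n that Q(x) ≠ 0 is at least 2^{-(d−1)} − 2^{O(d³)}/√s. -/

import Mathlib

open Finset
open scoped Classical

universe u

/-- Evaluation of a multilinear polynomial with coefficients `c` over an Abelian
group at a point of the Boolean cube. -/
def evalPoly {G : Type*} [AddCommMonoid G] {n : ℕ} (c : Finset (Fin n) → G)
    (x : Fin n → Bool) : G :=
  ∑ S : Finset (Fin n), if ∀ i ∈ S, x i = true then c S else 0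

namespace BoolPoly

/-- No nonzero element of `G` has order at most `K`. -/
def NoSmallTorsion (G : Type*) [AddCommGroup G] (K : ℕ) : Prop :=
  ∀ g : G, g ≠ 0 → ∀ m : ℕ, 0 < m → m ≤ K → m • g ≠ 0

theorem NoSmallTorsion.mono {G : Type*} [AddCommGroup G] {K L : ℕ} (h : NoSmallTorsion G L)
    (hKL : K ≤ L) : NoSmallTorsion G K :=
  fun g hg m hm hmK => h g hg m hm (hmK.trans hKL)

section LittlewoodOfford

/-- The sum of the `q` largest binomial coefficients `m.choose j`. -/
def chooseSum (m q : ℕ) : ℕ := ∑ r ∈ range q, m.choose ((m + r + 1) / 2)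

theorem choose_add_one_half (m r : ℕ) :
    (m + 1).choose ((m + 1 + (r + 1) + 1) / 2) =
      m.choose ((m + (r + 2) + 1) / 2) + m.choose ((m + r + 1) / 2) := by
  have h : (m + 1 + (r + 1) + 1) / 2 = (m + r + 1) / 2 + 1 := by omega
  have h' : (m + (r + 2) + 1) / 2 = (m + r + 1) / 2 + 1 := by omega
  rw [h, h', Nat.choose_succ_succ, add_comm]

theorem chooseSum_succ (m q : ℕ) :
    chooseSum (m + 1) (q + 1) = chooseSum m (q + 2) + chooseSum m q := by
  induction q with
  | zero =>
    have h : (m + 1 + 0 + 1) / 2 = m / 2 + 1 := by omega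
    have h' : (m + 1 + 1) / 2 = m / 2 + 1 := by omega
    have h'' : m.choose (m / 2) = m.choose ((m + 1) / 2) := by
      apply Nat.choose_symm_of_eq_add
      omega
    simp only [chooseSum, sum_range_succ, range_zero, sum_empty, zero_add, add_zero]
    rw [h', ← h'', ← Nat.choose_succ_succ]
  | succ q ih =>
    have e1 : chooseSum (m + 1) (q + 1 + 1) =
        chooseSum (m + 1) (q + 1) + (m + 1).choose ((m + 1 + (q + 1) + 1) / 2) :=
      sum_range_succ _ _
    have e2 : chooseSum m (q + 1 + 2) =
        chooseSum m (q + 2) + m.choose ((m + (q + 2) + 1) / 2) := sum_range_succ _ _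
    have e3 : chooseSum m (q + 1) = chooseSum m q + m.choose ((m + q + 1) / 2) :=
      sum_range_succ _ _
    rw [e1, e2, e3, ih, choose_add_one_half]
    ring

theorem choose_half_antitone (m : ℕ) : Antitone fun r => m.choose ((m + r + 1) / 2) := by
  apply antitone_nat_of_succ_le
  intro r
  obtain h | h : (m + (r + 1) + 1) / 2 = (m + r + 1) / 2 ∨
      (m + (r + 1) + 1) / 2 = (m + r + 1) / 2 + 1 := by omega
  · rw [h]
  · rw [h]
    generalize hj : (m + r + 1) / 2 = j at h ⊢
    have h1 := Nat.choose_succ_right_eq m j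
    have h2 : m - j ≤ j + 1 := by omega
    have h3 : m.choose (j + 1) * (j + 1) ≤ m.choose j * (j + 1) := by
      rw [h1]; exact Nat.mul_le_mul_left _ h2
    exact Nat.le_of_mul_le_mul_right h3 (Nat.succ_pos j)

theorem chooseSum_add_le (m q j : ℕ) :
    chooseSum m (q + j + 2 + j) + chooseSum m q ≤
      chooseSum m (q + j + 2) + chooseSum m (q + j) := by
  have key : ∀ i ≤ j, chooseSum m (q + j + 2 + i) + chooseSum m (q + j - i) ≤
      chooseSum m (q + j + 2) + chooseSum m (q + j) := by
    intro i
    induction i with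
    | zero => intro _; simp
    | succ i ih =>
      intro hi
      have h := ih (by omega)
      have e1 : chooseSum m (q + j + 2 + (i + 1)) =
          chooseSum m (q + j + 2 + i) + m.choose ((m + (q + j + 2 + i) + 1) / 2) :=
        sum_range_succ _ _
      have e2 : chooseSum m (q + j - i) =
          chooseSum m (q + j - (i + 1)) + m.choose ((m + (q + j - (i + 1)) + 1) / 2) := by
        have : q + j - i = q + j - (i + 1) + 1 := by omega
        rw [this]
        exact sum_range_succ _ _
      have e3 := choose_half_antitone m (show q + j - (i + 1) ≤ q + j + 2 + i by omega)
      simp only at e3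
      omega
  simpa using key j le_rfl

variable {ι : Type*} [DecidableEq ι] {G : Type*} [AddCommGroup G]

theorem card_lt_card_union_image_sub {T : Finset G} (hT : T.Nonempty)
    (hG : NoSmallTorsion G #T) {a : G} (ha : a ≠ 0) :
    #T < #(T ∪ T.image (· - a)) := by
  apply card_lt_card
  refine ⟨subset_union_left, fun h => ?_⟩
  obtain ⟨x, hx⟩ := hT
  have hmem : ∀ j : ℕ, x - j • a ∈ T := by
    intro j
    induction j with
    | zero => simpa using hx
    | succ j ih =>
      apply h
      refine mem_union_right _ (mem_image.2 ⟨_, ih, ?_⟩)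
      rw [succ_nsmul]
      abel
  obtain ⟨i, hi, j, hj, hij, he⟩ := exists_ne_map_eq_of_card_lt_of_maps_to
    (s := range (#T + 1)) (t := T) (by simp) (f := fun j => x - j • a) (fun j _ => hmem j)
  simp only [sub_right_inj] at he
  rw [mem_range] at hi hj
  wlog hlt : i < j generalizing i j
  · exact this j hj i hi hij.symm he.symm (by omega)
  refine hG a ha (j - i) (by omega) (by omega) ?_
  rw [sub_nsmul _ hlt.le, he]
  simp

theorem card_sum_mem_le (a : ι → G) (J : Finset ι) :
    ∀ T : Finset G, NoSmallTorsion G (2 ^ #J * #T) → (∀ i ∈ J, a i ≠ 0) →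
      ∑ Y ∈ J.powerset, (if ∑ i ∈ Y, a i ∈ T then 1 else 0) ≤ chooseSum #J #T := by
  induction J using Finset.induction_on with
  | empty =>
    intro T _ _
    rcases T.eq_empty_or_nonempty with rfl | hT
    · simp
    · obtain ⟨q, hq⟩ : ∃ q, #T = q + 1 := ⟨#T - 1, by have := hT.card_pos; omega⟩
      rw [hq]
      simp only [powerset_empty, sum_singleton, sum_empty, card_empty, chooseSum]
      refine le_trans ?_ (single_le_sum (fun _ _ => Nat.zero_le _) (mem_range.2 (Nat.succ_pos q)))
      simp only [zero_add, add_zero, Nat.reduceDiv, Nat.choose_self]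
      by_cases h : (0 : G) ∈ T <;> simp [h]
  | insert v J hv ih =>
    intro T hG ha
    rcases T.eq_empty_or_nonempty with rfl | hT
    · simp
    have hav := ha v (mem_insert_self v J)
    have haJ : ∀ i ∈ J, a i ≠ 0 := fun i hi => ha i (mem_insert_of_mem hi)
    rw [card_insert_of_notMem hv] at hG ⊢
    have hpos : 1 ≤ 2 ^ #J := Nat.one_le_two_pow
    set T' := T.image (· - a v) with hT'
    have hlt := card_lt_card_union_image_sub hT
      (hG.mono (Nat.le_mul_of_pos_left _ (by positivity))) hav
    have hcard := card_union_add_card_inter T T'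
    rw [hT', card_image_of_injective _ (sub_left_injective), ← hT'] at hcard
    rw [← hT'] at hlt
    have h1 := ih (T ∪ T') (hG.mono (by
      rw [pow_succ, mul_assoc]; exact Nat.mul_le_mul_left _ (by omega))) haJ
    have h2 := ih (T ∩ T') (hG.mono (by
      rw [pow_succ, mul_assoc]; exact Nat.mul_le_mul_left _ (by omega))) haJ
    have hsplit : ∑ Y ∈ (insert v J).powerset, (if ∑ i ∈ Y, a i ∈ T then 1 else 0) =
        ∑ Y ∈ J.powerset, (if ∑ i ∈ Y, a i ∈ T ∪ T' then 1 else 0) +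
        ∑ Y ∈ J.powerset, (if ∑ i ∈ Y, a i ∈ T ∩ T' then 1 else 0) := by
      rw [sum_powerset_insert hv, ← sum_add_distrib, ← sum_add_distrib]
      refine sum_congr rfl fun Y hY => ?_
      rw [sum_insert (fun h => hv (mem_powerset.1 hY h))]
      have hiff : a v + ∑ i ∈ Y, a i ∈ T ↔ ∑ i ∈ Y, a i ∈ T' := by
        rw [hT', mem_image]
        constructor
        · intro h
          exact ⟨_, h, by abel⟩
        · rintro ⟨x, hx, he⟩
          rw [← he]
          simpa using hx
      simp only [hiff, mem_union, mem_inter]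
      by_cases p : ∑ i ∈ Y, a i ∈ T <;> by_cases p' : ∑ i ∈ Y, a i ∈ T' <;> simp [p, p']
    rw [hsplit]
    obtain ⟨q, j, hq, hj⟩ : ∃ q j, #(T ∩ T') = q ∧ #T = q + j + 1 :=
      ⟨_, #T - #(T ∩ T') - 1, rfl, by omega⟩
    have hu : #(T ∪ T') = q + j + 2 + j := by omega
    rw [hj, chooseSum_succ]
    rw [hu] at h1
    rw [hq] at h2
    exact (add_le_add h1 h2).trans (chooseSum_add_le _ _ _)

theorem centralBinom_sq_mul_le (n : ℕ) : n.centralBinom ^ 2 * (2 * n + 1) ≤ 16 ^ n := by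
  induction n with
  | zero => simp
  | succ n ih =>
    have h := Nat.succ_mul_centralBinom_succ n
    have h2 : (n + 1) ^ 2 * ((n + 1).centralBinom ^ 2 * (2 * (n + 1) + 1)) ≤
        (n + 1) ^ 2 * 16 ^ (n + 1) := by
      calc (n + 1) ^ 2 * ((n + 1).centralBinom ^ 2 * (2 * (n + 1) + 1))
          = ((n + 1) * (n + 1).centralBinom) ^ 2 * (2 * n + 3) := by ring
        _ = (4 * ((2 * n + 1) * (2 * n + 3))) * (n.centralBinom ^ 2 * (2 * n + 1)) := by
          rw [h]; ring
        _ ≤ (4 * (4 * (n + 1) ^ 2)) * 16 ^ n := by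
          apply Nat.mul_le_mul _ ih
          nlinarith
        _ = _ := by ring
    exact Nat.le_of_mul_le_mul_left h2 (by positivity)

theorem choose_half_sq_mul_le (m : ℕ) : m.choose ((m + 1) / 2) ^ 2 * (m + 1) ≤ 4 ^ m := by
  obtain ⟨n, rfl | rfl⟩ := Nat.even_or_odd' m
  · have h : (2 * n + 1) / 2 = n := by omega
    rw [h, pow_mul, ← Nat.centralBinom_eq_two_mul_choose]
    exact centralBinom_sq_mul_le n
  · have h : (2 * n + 1 + 1) / 2 = n + 1 := by omega
    have h1 := centralBinom_sq_mul_le (n + 1)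
    have h2 : (n + 1).centralBinom = 2 * (2 * n + 1).choose (n + 1) := by
      have h3 : (2 * n + 1).choose n = (2 * n + 1).choose (n + 1) :=
        Nat.choose_symm_of_eq_add (by omega)
      rw [Nat.centralBinom_eq_two_mul_choose, show 2 * (n + 1) = 2 * n + 1 + 1 by ring,
        Nat.choose_succ_succ, h3]
      ring
    rw [h2] at h1
    rw [h]
    have e1 : (16 : ℕ) ^ (n + 1) = 4 * 4 ^ (2 * n + 1) := by
      rw [show (16 : ℕ) = 4 ^ 2 by norm_num, ← pow_mul]; ring
    rw [e1] at h1
    nlinarith [Nat.zero_le ((2 * n + 1).choose (n + 1) ^ 2)]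

theorem sum_powerset_union {M : Type*} [AddCommMonoid M] {A B : Finset ι} (h : Disjoint A B)
    (f : Finset ι → M) :
    ∑ X ∈ (A ∪ B).powerset, f X = ∑ Y ∈ B.powerset, ∑ X ∈ A.powerset, f (X ∪ Y) := by
  induction B using Finset.induction_on generalizing f with
  | empty => simp
  | insert v B hv ih =>
    rw [disjoint_insert_right] at h
    rw [union_insert, sum_powerset_insert (by simp [h.1, hv]), sum_powerset_insert hv, ih h.2,
      ih h.2]
    simp only [union_insert]

/-- **Erdős's Littlewood–Offord bound** in an Abelian group: the value distribution of a linear form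
with coefficients nonzero on `J`. -/
theorem card_sum_eq_le {a : ι → G} {J W : Finset ι} (hJW : J ⊆ W)
    (hG : NoSmallTorsion G (2 ^ #J)) (ha : ∀ i ∈ J, a i ≠ 0) (b : G) :
    ∑ Y ∈ W.powerset, (if ∑ i ∈ Y, a i = b then 1 else 0) ≤
      2 ^ #(W \ J) * (#J).choose ((#J + 1) / 2) := by
  conv_lhs => rw [← union_sdiff_of_subset hJW]
  rw [sum_powerset_union disjoint_sdiff]
  rw [← card_powerset, ← smul_eq_mul]
  apply sum_le_card_nsmul
  intro Y hY
  have h := card_sum_mem_le a J {b - ∑ i ∈ Y, a i} (by simpa using hG) ha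
  simp only [card_singleton, chooseSum, sum_range_one, add_zero] at h
  refine le_trans (le_of_eq (sum_congr rfl fun X hX => ?_)) h
  have hd : Disjoint X Y := disjoint_of_subset_left (mem_powerset.1 hX)
    (disjoint_of_subset_right (mem_powerset.1 hY) disjoint_sdiff)
  simp only [sum_union hd, mem_singleton, eq_sub_iff_add_eq]

theorem card_sum_eq_sq_mul_le {a : ι → G} {J W : Finset ι} (hJW : J ⊆ W)
    (hG : NoSmallTorsion G (2 ^ #J)) (ha : ∀ i ∈ J, a i ≠ 0) (b : G) :
    (∑ Y ∈ W.powerset, (if ∑ i ∈ Y, a i = b then 1 else 0)) ^ 2 * (#J + 1) ≤ 4 ^ #W :=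
  calc _ ≤ (2 ^ #(W \ J) * (#J).choose ((#J + 1) / 2)) ^ 2 * (#J + 1) := by
        gcongr; exact card_sum_eq_le hJW hG ha b
    _ = 4 ^ #(W \ J) * ((#J).choose ((#J + 1) / 2) ^ 2 * (#J + 1)) := by
      rw [mul_pow, ← pow_mul, mul_comm _ 2, pow_mul]; ring
    _ ≤ 4 ^ #(W \ J) * 4 ^ #J := by gcongr; exact choose_half_sq_mul_le _
    _ = 4 ^ #W := by rw [← pow_add, card_sdiff_add_card_eq_card hJW]

end LittlewoodOfford

section Polynomials

variable {ι : Type*} [DecidableEq ι] {G : Type*} [AddCommGroup G]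

/-- The value at the indicator vector of `X` of the multilinear polynomial with coefficients `c`. -/
def ev (c : Finset ι → G) (X : Finset ι) : G := ∑ S ∈ X.powerset, c S

/-- The coefficients of the iterated derivative in the directions of `U`. -/
def link (c : Finset ι → G) (U S : Finset ι) : G := c (S ∪ U)

/-- The coefficients after fixing the variables of `Y` to `1`. When `Y ⊆ A`, on subsets of the
complement of `A` these are the coefficients of the restriction to the subcube in which the
variables of `A` are given by the indicator of `Y`. -/
def res (c : Finset ι → G) (Y S : Finset ι) : G := ev (link c S) Y

/-- The number of points of the cube `{0, 1} ^ W` at which the polynomial does not vanish. -/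
noncomputable def nz (c : Finset ι → G) (W : Finset ι) : ℕ :=
  ∑ X ∈ W.powerset, if ev c X ≠ 0 then 1 else 0

@[simp] theorem ev_empty {ι : Type*} (c : Finset ι → G) : ev c ∅ = c ∅ := by simp [ev]

theorem ev_insert (c : Finset ι → G) {v : ι} {X : Finset ι} (hv : v ∉ X) :
    ev c (insert v X) = ev c X + ev (link c {v}) X := by
  rw [ev, sum_powerset_insert hv]
  congr 1
  exact sum_congr rfl fun S _ => by rw [link, union_comm, insert_eq]

theorem ev_union (c : Finset ι → G) {X Y : Finset ι} (h : Disjoint X Y) :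
    ev c (X ∪ Y) = ev (res c Y) X := by
  rw [ev, sum_powerset_union h, sum_comm]
  exact sum_congr rfl fun S _ => sum_congr rfl fun T _ => by rw [link, union_comm]

theorem link_link {ι G : Type*} [DecidableEq ι] (c : Finset ι → G) (U V : Finset ι) :
    link (link c U) V = link c (U ∪ V) := by
  funext S
  simp only [link, union_assoc, union_comm V U]

/-- A polynomial without monomials of degree `≥ 2` is affine. -/
theorem ev_eq_of_affine {c : Finset ι → G} {X : Finset ι} (h : ∀ S ⊆ X, 2 ≤ #S → c S = 0) :
    ev c X = c ∅ + ∑ x ∈ X, c {x} := by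
  induction X using Finset.induction_on with
  | empty => simp
  | insert v X hv ih =>
    rw [ev_insert _ hv, sum_insert hv, ih fun S hS => h S (hS.trans (subset_insert _ _))]
    have : ev (link c {v}) X = c {v} := by
      rw [ev, sum_eq_single ∅]
      · simp [link]
      · intro S hS hne
        rw [mem_powerset] at hS
        have hvS : v ∉ S := fun h => hv (hS h)
        apply h
        · rw [union_comm, ← insert_eq]
          exact insert_subset_insert _ hS
        · rw [union_comm, ← insert_eq, card_insert_of_notMem hvS]
          have := card_pos.2 (nonempty_iff_ne_empty.2 hne)
          omega
      · simp
    rw [this]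
    abel

/-- Counting the nonzeros and the zeros of an affine polynomial. -/
theorem nz_add_sum_of_affine {c : Finset ι → G} {W : Finset ι} (h : ∀ S ⊆ W, 2 ≤ #S → c S = 0) :
    nz c W + ∑ X ∈ W.powerset, (if ∑ x ∈ X, c {x} = - c ∅ then 1 else 0) = 2 ^ #W := by
  rw [nz, ← sum_add_distrib, ← card_powerset, card_eq_sum_ones]
  refine sum_congr rfl fun X hX => ?_
  rw [ev_eq_of_affine fun S hS => h S (hS.trans (mem_powerset.1 hX))]
  have : c ∅ + ∑ x ∈ X, c {x} = 0 ↔ ∑ x ∈ X, c {x} = - c ∅ := by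
    rw [add_comm, eq_neg_iff_add_eq_zero]
  by_cases h0 : ∑ x ∈ X, c {x} = - c ∅
  · simp [h0]
  · simp [this, h0]

theorem nz_union (c : Finset ι → G) {A B : Finset ι} (h : Disjoint A B) :
    nz c (A ∪ B) = ∑ Y ∈ B.powerset, nz (res c Y) A := by
  rw [nz, sum_powerset_union h]
  refine sum_congr rfl fun Y hY => sum_congr rfl fun X hX => ?_
  rw [ev_union c (disjoint_of_subset_left (mem_powerset.1 hX)
    (disjoint_of_subset_right (mem_powerset.1 hY) h))]

theorem nz_eq_sum_res (c : Finset ι → G) {U W : Finset ι} (h : U ⊆ W) :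
    nz c W = ∑ Y ∈ (W \ U).powerset, nz (res c Y) U := by
  rw [← nz_union c disjoint_sdiff, union_sdiff_of_subset h]

theorem nz_link_le (c : Finset ι → G) {U W : Finset ι} (hU : U ⊆ W) :
    nz (link c U) (W \ U) ≤ nz c W := by
  induction U using Finset.induction_on generalizing c W with
  | empty =>
    have : link c ∅ = c := by funext S; simp [link]
    simp [this]
  | insert v U hv ih =>
    rw [insert_subset_iff] at hU
    have h1 : link c (insert v U) = link (link c {v}) U := by rw [link_link, insert_eq]
    have h2 : W \ insert v U = W.erase v \ U := by
      ext x
      simp only [mem_sdiff, mem_insert, mem_erase]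
      tauto
    rw [h1, h2]
    refine (ih (link c {v}) (fun x hx => mem_erase.2 ⟨?_, hU.2 hx⟩)).trans ?_
    · rintro rfl
      exact hv hx
    · conv_rhs => rw [← insert_erase hU.1]
      rw [nz, nz, sum_powerset_insert (notMem_erase _ _), ← sum_add_distrib]
      refine sum_le_sum fun X hX => ?_
      have hvX : v ∉ X := fun h => notMem_erase v W (mem_powerset.1 hX h)
      rw [ev_insert _ hvX]
      by_cases h : ev c X = 0
      · simp [h]
      · simp only [ne_eq, h, not_false_eq_true, if_true]
        split_ifs <;> omega

theorem nz_pos {c : Finset ι → G} {W : Finset ι} (h : c W ≠ 0) : 0 < nz c W := by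
  have h1 := nz_link_le c (Subset.refl W)
  have h2 : W \ W = ∅ := by simp
  have h3 : nz (link c W) ∅ = 1 := by simp [nz, link, h]
  rw [h2, h3] at h1
  exact h1

/-- Comparing a polynomial with its reflection in the variables of `A`. -/
theorem sum_nz_res_sub_res_le (c : Finset ι → G) {A B : Finset ι} (h : Disjoint B A) :
    ∑ Y ∈ A.powerset, nz (fun S => res c Y S - res c (A \ Y) S) B ≤ 2 * nz c (B ∪ A) := by
  have h1 : ∑ Y ∈ A.powerset, nz (res c (A \ Y)) B = ∑ Y ∈ A.powerset, nz (res c Y) B := by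
    refine sum_nbij' (A \ ·) (A \ ·) ?_ ?_ ?_ ?_ ?_
    · simp
    · simp
    · intro Y hY
      simpa using hY
    · intro Y hY
      simpa using hY
    · simp
  rw [nz_union c h, two_mul]
  nth_rewrite 2 [← h1]
  rw [← sum_add_distrib]
  refine sum_le_sum fun Y _ => ?_
  unfold nz
  rw [← sum_add_distrib]
  refine sum_le_sum fun X _ => ?_
  have h2 : ev (fun S => res c Y S - res c (A \ Y) S) X =
      ev (res c Y) X - ev (res c (A \ Y)) X := sum_sub_distrib _ _
  rw [h2]
  by_cases e1 : ev (res c Y) X = 0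
  · by_cases e2 : ev (res c (A \ Y)) X = 0 <;> simp [e1, e2]
  · simp only [ne_eq, e1, not_false_eq_true, if_true]
    split_ifs <;> omega

end Polynomials

section Matchings

variable {ι : Type*} [DecidableEq ι] {G : Type*} [AddCommGroup G]

/-- Among the monomials of degree at least `d` in the variables of the sets `S i`, exactly the
four disjoint sets `S i` of size `d` have nonzero coefficients. -/
structure IsMatching (c : Finset ι → G) (d : ℕ) (S : Fin 4 → Finset ι) : Prop where
  card : ∀ i, #(S i) = d
  disj : ∀ i j, i ≠ j → Disjoint (S i) (S j)
  ne : ∀ i, c (S i) ≠ 0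
  zero : ∀ T ⊆ univ.biUnion S, d ≤ #T → (∀ i, T ≠ S i) → c T = 0

namespace IsMatching

variable {c : Finset ι → G} {d : ℕ} {S : Fin 4 → Finset ι} {v : Fin 4 → ι}

theorem disjoint_image (h : IsMatching c d S) (hv : ∀ i, v i ∈ S i) :
    Disjoint (univ.biUnion fun i => (S i).erase (v i)) (univ.image v) := by
  rw [disjoint_right]
  intro x hx hx'
  simp only [mem_image, mem_univ, true_and, mem_biUnion, mem_erase] at hx hx'
  obtain ⟨i, rfl⟩ := hx
  obtain ⟨j, hj, hj'⟩ := hx'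
  have hij : i ≠ j := by
    rintro rfl
    exact hj rfl
  exact disjoint_left.1 (h.disj i j hij) (hv i) hj'

theorem biUnion_erase_union_image (hv : ∀ i, v i ∈ S i) :
    (univ.biUnion fun i => (S i).erase (v i)) ∪ univ.image v = univ.biUnion S := by
  ext x
  simp only [mem_union, mem_image, mem_univ, true_and, mem_biUnion, mem_erase]
  constructor
  · rintro (⟨i, -, hi⟩ | ⟨i, rfl⟩)
    · exact ⟨i, hi⟩
    · exact ⟨i, hv i⟩
  · rintro ⟨i, hi⟩
    by_cases hx : x = v i
    · exact Or.inr ⟨i, hx.symm⟩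
    · exact Or.inl ⟨i, hx, hi⟩

theorem injective_of_mem (h : IsMatching c d S) (hv : ∀ i, v i ∈ S i) : Function.Injective v := by
  intro i j hij
  by_contra hne
  exact disjoint_left.1 (h.disj i j hne) (hv i) (hij ▸ hv j)

theorem exists_eq_of_ne_zero (h : IsMatching c (d + 1) S) (hv : ∀ i, v i ∈ S i) {R T : Finset ι}
    (hR : R ⊆ univ.image v) (hR' : R ≠ ∅) (hT : T ⊆ univ.biUnion fun i => (S i).erase (v i))
    (hd : d ≤ #T) (hc : c (R ∪ T) ≠ 0) : ∃ j, R = {v j} ∧ T = (S j).erase (v j) := by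
  have hRT : Disjoint R T :=
    disjoint_of_subset_left hR (disjoint_of_subset_right hT (h.disjoint_image hv).symm)
  have hsub : R ∪ T ⊆ univ.biUnion S := by
    rw [← biUnion_erase_union_image hv, union_comm]
    exact union_subset_union hT hR
  have hcard : d + 1 ≤ #(R ∪ T) := by
    rw [card_union_of_disjoint hRT]
    have := card_pos.2 (nonempty_iff_ne_empty.2 hR')
    omega
  have : ∃ j, R ∪ T = S j := by
    by_contra! hne
    exact hc (h.zero _ hsub hcard hne)
  obtain ⟨j, hj⟩ := this
  have hRj : R = {v j} := by
    refine (subset_singleton_iff.1 ?_).resolve_left hR'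
    intro x hx
    obtain ⟨i, -, rfl⟩ := mem_image.1 (hR hx)
    have hij : i = j := by
      by_contra hne
      exact disjoint_left.1 (h.disj i j hne) (hv i) (hj ▸ mem_union_left _ hx)
    rw [hij, mem_singleton]
  refine ⟨j, hRj, ?_⟩
  subst hRj
  rw [← hj, ← insert_eq, erase_insert (disjoint_singleton_left.1 hRT)]

theorem res_eq (h : IsMatching c (d + 1) S) (hv : ∀ i, v i ∈ S i) {Y T : Finset ι}
    (hY : Y ⊆ univ.image v) (hT : T ⊆ univ.biUnion fun i => (S i).erase (v i))
    (hd : d ≤ #T) (hTS : ∀ i, T ≠ (S i).erase (v i)) : res c Y T = c T := by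
  rw [res, ev, sum_eq_single ∅]
  · simp [link]
  · intro R hR hR'
    by_contra hc
    obtain ⟨j, -, hj⟩ := h.exists_eq_of_ne_zero hv ((mem_powerset.1 hR).trans hY) hR' hT hd hc
    exact hTS j hj
  · simp

theorem res_erase (h : IsMatching c (d + 1) S) (hd : 0 < d) (hv : ∀ i, v i ∈ S i) {Y : Finset ι}
    (hY : Y ⊆ univ.image v) (i : Fin 4) :
    res c Y ((S i).erase (v i)) = c ((S i).erase (v i)) + if v i ∈ Y then c (S i) else 0 := by
  have hcard : #((S i).erase (v i)) = d := by
    rw [card_erase_of_mem (hv i), h.card, Nat.add_sub_cancel]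
  have hsub : (S i).erase (v i) ⊆ univ.biUnion fun i => (S i).erase (v i) :=
    subset_biUnion_of_mem (fun i => (S i).erase (v i)) (mem_univ i)
  have key : ∀ R ∈ Y.powerset, R ≠ ∅ → R ≠ {v i} → link c ((S i).erase (v i)) R = 0 := by
    intro R hR hR' hRi
    by_contra hc
    obtain ⟨j, rfl, hj⟩ :=
      h.exists_eq_of_ne_zero hv ((mem_powerset.1 hR).trans hY) hR' hsub hcard.ge hc
    have hij : i ≠ j := by
      rintro rfl
      exact hRi rfl
    obtain ⟨x, hx⟩ := card_pos.1 (hcard ▸ hd)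
    exact disjoint_left.1 (h.disj i j hij) (mem_of_mem_erase hx) (mem_of_mem_erase (hj ▸ hx))
  have hS : {v i} ∪ (S i).erase (v i) = S i := by rw [← insert_eq, insert_erase (hv i)]
  rw [res, ev]
  by_cases hi : v i ∈ Y
  · rw [if_pos hi, sum_eq_add_of_mem ∅ {v i} (empty_mem_powerset _) (by simpa using hi)
      (singleton_ne_empty _).symm fun R hR hne => key R hR hne.1 hne.2]
    simp [link, hS]
  · rw [if_neg hi, add_zero, sum_eq_single_of_mem ∅ (empty_mem_powerset _) fun R hR hne =>
      key R hR hne ?_]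
    · simp [link]
    · rintro rfl
      exact hi (by simpa using hR)

/-- The fiberwise count in the case of degree two. -/
theorem sum_card_filter_iff (Γ : Finset (Fin 4)) :
    ∑ P : Finset (Fin 4), (16 - 2 ^ (4 - #{i | i ∈ P ↔ i ∈ Γ}) *
      (#{i | i ∈ P ↔ i ∈ Γ}).choose ((#{i | i ∈ P ↔ i ∈ Γ} + 1) / 2)) = 130 := by
  revert Γ
  decide +kernel

theorem le_nz_of_two (hG : NoSmallTorsion G 16) (h : IsMatching c 2 S) :
    2 ^ #(univ.biUnion S) ≤ 2 * nz c (univ.biUnion S) := by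
  have hex : ∀ i, ∃ x y, x ≠ y ∧ S i = {x, y} := fun i => card_eq_two.1 (h.card i)
  choose x v hxv hS using hex
  have hv : ∀ i, v i ∈ S i := fun i => by simp [hS]
  have hxS : ∀ i, x i ∈ S i := fun i => by simp [hS]
  have hS' : ∀ i, (S i).erase (v i) = {x i} := fun i => by
    rw [hS]
    ext y
    simp only [mem_erase, mem_insert, mem_singleton]
    constructor
    · tauto
    · rintro rfl
      exact ⟨hxv i, Or.inl rfl⟩
  have hxinj := h.injective_of_mem hxS
  have hvinj := h.injective_of_mem hv
  have hB : (univ.biUnion fun i => (S i).erase (v i)) = univ.image x := by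
    ext y
    simp [hS', eq_comm]
  have hdisj := h.disjoint_image hv
  have hcardB : #(univ.image x) = 4 := by rw [card_image_of_injective _ hxinj]; rfl
  have hcardA : #(univ.image v) = 4 := by rw [card_image_of_injective _ hvinj]; rfl
  rw [← biUnion_erase_union_image hv, card_union_of_disjoint hdisj, nz_union c hdisj, hB, hcardA,
    hcardB]
  set Γ : Finset (Fin 4) := {i | c {x i} = 0} with hΓ
  have hsum : ∑ Y ∈ (univ.image v).powerset, nz (res c Y) (univ.image x) =
      ∑ P : Finset (Fin 4), nz (res c (P.image v)) (univ.image x) := by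
    symm
    refine sum_bij (fun P _ => P.image v) ?_ ?_ ?_ ?_
    · intro P _
      exact mem_powerset.2 (image_subset_image (subset_univ _))
    · intro P _ Q _ hPQ
      exact image_injective hvinj hPQ
    · intro Y hY
      obtain ⟨P, -, hP⟩ := subset_image_iff.1 (mem_powerset.1 hY)
      exact ⟨P, mem_univ _, hP⟩
    · intros
      rfl
  have hfib : ∀ P : Finset (Fin 4), 16 - 2 ^ (4 - #{i | i ∈ P ↔ i ∈ Γ}) *
      (#{i | i ∈ P ↔ i ∈ Γ}).choose ((#{i | i ∈ P ↔ i ∈ Γ} + 1) / 2) ≤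
        nz (res c (P.image v)) (univ.image x) := by
    intro P
    set b := res c (P.image v) with hb
    have hPA : P.image v ⊆ univ.image v := image_subset_image (subset_univ _)
    have haff : ∀ T ⊆ univ.image x, 2 ≤ #T → b T = 0 := by
      intro T hT hT2
      rw [hb, h.res_eq hv hPA (hB ▸ hT) (by omega)]
      · refine h.zero T (hT.trans ?_) hT2 ?_
        · rw [← biUnion_erase_union_image hv, hB]
          exact subset_union_left
        · rintro i rfl
          exact disjoint_right.1 hdisj (mem_image_of_mem v (mem_univ i)) (hB ▸ hT (hv i))
      · rintro i rfl
        rw [hS', card_singleton] at hT2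
        omega
    set J : Finset ι := image x ({i | i ∈ P ↔ i ∈ Γ} : Finset (Fin 4)) with hJ
    have hJc : #J = #{i | i ∈ P ↔ i ∈ Γ} := card_image_of_injective _ hxinj
    have hJsub : J ⊆ univ.image x := image_subset_image (subset_univ _)
    have hJ4 : #J ≤ 4 := hcardB ▸ card_le_card hJsub
    have hJ16 : 2 ^ #J ≤ 16 := (Nat.pow_le_pow_right (by norm_num) hJ4).trans (by norm_num)
    have hne : ∀ y ∈ J, b {y} ≠ 0 := by
      intro y hy
      obtain ⟨i, hi, rfl⟩ := mem_image.1 hy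
      have h1 := h.res_erase one_pos hv hPA i
      rw [hS'] at h1
      simp only [hb, h1, hvinj.mem_finset_image]
      rw [mem_filter, hΓ, mem_filter] at hi
      simp only [mem_univ, true_and] at hi
      by_cases hiP : i ∈ P
      · rw [if_pos hiP, hi.1 hiP, zero_add]
        exact h.ne i
      · rw [if_neg hiP, add_zero]
        exact fun h0 => hiP (hi.2 h0)
    have hLO := card_sum_eq_le hJsub (hG.mono hJ16) hne (- b ∅)
    rw [card_sdiff_of_subset hJsub, hcardB, hJc] at hLO
    have htot := nz_add_sum_of_affine haff
    rw [hcardB] at htot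
    omega
  rw [hsum]
  have := (sum_card_filter_iff Γ).symm.le.trans (sum_le_sum fun P _ => hfib P)
  omega

theorem le_nz (hG : NoSmallTorsion G 16) (hd : 2 ≤ d) {c : Finset ι → G} {S : Fin 4 → Finset ι}
    (h : IsMatching c d S) :
    2 ^ #(univ.biUnion S) ≤ 2 ^ (d - 1) * nz c (univ.biUnion S) := by
  induction d, hd using Nat.le_induction generalizing c S with
  | base => simpa using h.le_nz_of_two hG
  | succ d hd ih =>
    have hex : ∀ i, ∃ y, y ∈ S i := fun i => card_pos.1 (by rw [h.card]; omega)
    choose v hv using hex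
    have hdisj := h.disjoint_image hv
    set B := univ.biUnion fun i => (S i).erase (v i) with hB
    set A := univ.image v with hA
    have hfib : ∀ Y ∈ A.powerset,
        2 ^ #B ≤ 2 ^ (d - 1) * nz (fun T => res c Y T - res c (A \ Y) T) B := by
      intro Y hY
      rw [mem_powerset] at hY
      apply ih
      constructor
      · intro i
        rw [card_erase_of_mem (hv i), h.card, Nat.add_sub_cancel]
      · intro i j hij
        exact disjoint_of_subset_left (erase_subset _ _)
          (disjoint_of_subset_right (erase_subset _ _) (h.disj i j hij))
      · intro i
        have hvA : v i ∈ A := mem_image_of_mem v (mem_univ i)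
        have h1 := h.res_erase (by omega) hv hY i
        have h2 := h.res_erase (by omega) hv (sdiff_subset (s := A) (t := Y)) i
        simp only [h1, h2, add_sub_add_left_eq_sub, mem_sdiff, hvA, true_and]
        by_cases hi : v i ∈ Y <;> simp [hi, h.ne i]
      · intro T hT hdT hne
        rw [h.res_eq hv hY hT hdT hne, h.res_eq hv sdiff_subset hT hdT hne, sub_self]
    have hsum := sum_le_sum hfib
    rw [sum_const, card_powerset, smul_eq_mul, ← mul_sum] at hsum
    have h2 := Nat.mul_le_mul_left (2 ^ (d - 1)) (sum_nz_res_sub_res_le c hdisj)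
    rw [← biUnion_erase_union_image hv, card_union_of_disjoint hdisj, pow_add, mul_comm,
      Nat.add_sub_cancel]
    refine (hsum.trans h2).trans_eq ?_
    obtain ⟨e, rfl⟩ : ∃ e, d = e + 1 := ⟨d - 1, by omega⟩
    simp only [Nat.add_sub_cancel, pow_succ]
    ring

end IsMatching

end Matchings

section Gain

variable {ι : Type*} [DecidableEq ι] {G : Type*} [AddCommGroup G]

theorem eq_sum_ev (c : Finset ι → G) (U : Finset ι) :
    c U = ∑ X ∈ U.powerset, (-1 : ℤ) ^ #(U \ X) • ev c X := by
  induction U using Finset.induction_on generalizing c with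
  | empty => simp
  | insert v U hv ih =>
    have h1 : c (insert v U) = link c {v} U := by rw [link, union_comm, insert_eq]
    rw [h1, ih (link c {v}), sum_powerset_insert hv, ← sum_add_distrib]
    refine sum_congr rfl fun X hX => ?_
    have hvX : v ∉ X := fun h => hv (mem_powerset.1 hX h)
    have h2 : insert v U \ insert v X = U \ X := by
      rw [insert_sdiff_insert, sdiff_insert_of_notMem hv]
    rw [ev_insert c hvX, h2, insert_sdiff_of_notMem _ hvX,
      card_insert_of_notMem fun h => hv (mem_sdiff.1 h).1, pow_succ]
    simp

theorem eq_of_nz_eq_one {c : Finset ι → G} {U X : Finset ι} (h : nz c U = 1) (hX : X ⊆ U)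
    (hc : ev c X ≠ 0) : c U = (-1 : ℤ) ^ #(U \ X) • ev c X := by
  rw [eq_sum_ev c U, sum_eq_single_of_mem X (mem_powerset.2 hX)]
  intro Y hY hne
  by_contra h0
  have hcY : ev c Y ≠ 0 := fun h => h0 (by rw [h, smul_zero])
  have : ∑ Z ∈ {X, Y}, (if ev c Z ≠ 0 then 1 else 0) ≤ nz c U :=
    sum_le_sum_of_subset (by simpa [insert_subset_iff, hX] using hY)
  rw [sum_pair hne.symm, if_pos hc, if_pos hcY] at this
  omega

theorem exists_of_nz_pos {ι : Type*} {c : Finset ι → G} {U : Finset ι} (h : 0 < nz c U) :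
    ∃ X ⊆ U, ev c X ≠ 0 := by
  by_contra! h0
  refine h.ne' (sum_eq_zero fun X hX => ?_)
  simp [h0 X (mem_powerset.1 hX)]

theorem nz_res_eq_one {h : Finset ι → G} {U W : Finset ι} (hU : U ⊆ W)
    (hpos : ∀ R ⊆ W \ U, ev (link h U) R ≠ 0) (hle : nz h W ≤ 2 ^ #(W \ U)) :
    ∀ R ⊆ W \ U, nz (res h R) U = 1 := by
  have h1 : ∀ R ∈ (W \ U).powerset, 1 ≤ nz (res h R) U := fun R hR =>
    nz_pos (hpos R (mem_powerset.1 hR))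
  intro R hR
  rw [nz_eq_sum_res h hU, ← card_powerset, card_eq_sum_ones] at hle
  exact ((sum_eq_sum_iff_of_le h1).1 (le_antisymm (sum_le_sum h1) hle) R
    (mem_powerset.2 hR)).symm

theorem exists_of_nz_le {h : Finset ι → G} {U₁ U₂ U₃ : Finset ι} {e : ℕ} {u : ι}
    (h₁₂ : Disjoint U₁ U₂) (h₁₃ : Disjoint U₁ U₃) (h₂₃ : Disjoint U₂ U₃)
    (hc₁ : #U₁ = e) (hc₂ : #U₂ = e) (hc₃ : #U₃ = e) (hu : u ∈ U₂)
    (hpos₁ : ∀ R ⊆ (U₁ ∪ U₂ ∪ U₃) \ U₁, ev (link h U₁) R ≠ 0)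
    (hpos₂ : ∀ R ⊆ (U₁ ∪ U₂ ∪ U₃) \ U₂, ev (link h U₂) R ≠ 0)
    (hpos₃ : ∀ R ⊆ (U₁ ∪ U₂ ∪ U₃) \ U₃, ev (link h U₃) R ≠ 0)
    (hle : nz h (U₁ ∪ U₂ ∪ U₃) ≤ 2 ^ (2 * e)) :
    ∃ X ⊆ U₃, ∃ X' ⊆ U₃, ev (link h U₁) X = ev (link h U₂) X ∧
      ev (link h U₁) (insert u X') = - ev (link h U₂) X' := by
  set W := U₁ ∪ U₂ ∪ U₃ with hW
  have hs₁ : U₁ ⊆ W := subset_union_left.trans subset_union_left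
  have hs₂ : U₂ ⊆ W := subset_union_right.trans subset_union_left
  have hs₃ : U₃ ⊆ W := subset_union_right
  have hWc : #W = 3 * e := by
    rw [hW, card_union_of_disjoint (disjoint_union_left.2 ⟨h₁₃, h₂₃⟩),
      card_union_of_disjoint h₁₂]
    omega
  have hone₁ := nz_res_eq_one hs₁ hpos₁
    (by rw [card_sdiff_of_subset hs₁, hWc, hc₁]; convert hle using 2; omega)
  have hone₂ := nz_res_eq_one hs₂ hpos₂
    (by rw [card_sdiff_of_subset hs₂, hWc, hc₂]; convert hle using 2; omega)
  have hone₃ := nz_res_eq_one hs₃ hpos₃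
    (by rw [card_sdiff_of_subset hs₃, hWc, hc₃]; convert hle using 2; omega)
  have huW : {u} ⊆ W \ U₃ := by
    rw [singleton_subset_iff, mem_sdiff]
    exact ⟨hs₂ hu, disjoint_left.1 h₂₃ hu⟩
  have evres : ∀ {R X U : Finset ι}, Disjoint X R → ev (res h R) X = ev h (X ∪ R) :=
    fun hXR => (ev_union h hXR).symm
  have key : ∀ {U R X : Finset ι}, Disjoint X R → nz (res h R) U = 1 → X ⊆ U → ev h (X ∪ R) ≠ 0 →
      ev (link h U) R = (-1 : ℤ) ^ #(U \ X) • ev h (X ∪ R) := by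
    intro U R X hXR h1 hXU hne
    rw [ev_union h hXR] at hne ⊢
    exact eq_of_nz_eq_one h1 hXU hne
  obtain ⟨X, hX, hXne⟩ := exists_of_nz_pos (zero_lt_one.trans_eq (hone₃ ∅ (empty_subset _)).symm)
  obtain ⟨X', hX', hXne'⟩ := exists_of_nz_pos (zero_lt_one.trans_eq (hone₃ {u} huW).symm)
  rw [← ev_union h (disjoint_empty_right _), union_empty] at hXne
  have huX' : Disjoint X' {u} :=
    disjoint_singleton_right.2 fun hu' => disjoint_left.1 h₂₃ hu (hX' hu')
  rw [← ev_union h huX', union_comm] at hXne'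
  have hsub₁ : ∀ Y ⊆ U₃, Y ⊆ W \ U₁ := fun Y hY => subset_sdiff.2
    ⟨hY.trans hs₃, disjoint_of_subset_left hY h₁₃.symm⟩
  have hsub₂ : ∀ Y ⊆ U₃, Y ⊆ W \ U₂ := fun Y hY => subset_sdiff.2
    ⟨hY.trans hs₃, disjoint_of_subset_left hY h₂₃.symm⟩
  have huX₁ : insert u X' ⊆ W \ U₁ := insert_subset
    (mem_sdiff.2 ⟨hs₂ hu, disjoint_right.1 h₁₂ hu⟩) (hsub₁ X' hX')
  refine ⟨X, hX, X', hX', ?_, ?_⟩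
  · rw [key (disjoint_empty_left _) (hone₁ X (hsub₁ X hX)) (empty_subset _) (by simpa using hXne),
      key (disjoint_empty_left _) (hone₂ X (hsub₂ X hX)) (empty_subset _) (by simpa using hXne)]
    simp [hc₁, hc₂]
  · obtain ⟨f, rfl⟩ : ∃ f, e = f + 1 := ⟨e - 1, by have := card_pos.2 ⟨u, hu⟩; omega⟩
    rw [key (disjoint_empty_left _) (hone₁ _ huX₁) (empty_subset _)
        (by rwa [empty_union, insert_eq]),
      key huX'.symm (hone₂ X' (hsub₂ X' hX')) (singleton_subset_iff.2 hu) hXne']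
    have hcard : #(U₂ \ {u}) = f := by
      rw [card_sdiff_of_subset (singleton_subset_iff.2 hu), hc₂, card_singleton,
        Nat.add_sub_cancel]
    rw [sdiff_empty, hc₁, hcard, empty_union, ← insert_eq, pow_succ, mul_neg_one, neg_smul]

/-- Union bound for events of Littlewood–Offord type. -/
theorem card_exists_sum_eq_mul_le {Z J : Finset ι} {k : ℕ} (hJ : J ⊆ Z) (hk : 4 ^ k ≤ #J)
    (hG : NoSmallTorsion G (2 ^ 4 ^ k)) {a : ι → G} (ha : ∀ i ∈ J, a i ≠ 0) {κ : Type*}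
    (E : Finset κ) (b : κ → G) :
    #{Y ∈ Z.powerset | ∃ p ∈ E, ∑ i ∈ Y, a i = b p} * 2 ^ k ≤ #E * 2 ^ #Z := by
  obtain ⟨J', hJ'J, hJ'⟩ := exists_subset_card_eq hk
  have h1 : ∀ p, #{Y ∈ Z.powerset | ∑ i ∈ Y, a i = b p} * 2 ^ k ≤ 2 ^ #Z := by
    intro p
    have := card_sum_eq_sq_mul_le (hJ'J.trans hJ) (hJ' ▸ hG) (fun i hi => ha i (hJ'J hi)) (b p)
    rw [← card_filter, hJ'] at this
    have h4 : ∀ m : ℕ, 4 ^ m = (2 ^ m) ^ 2 := fun m => by rw [← pow_mul, mul_comm, pow_mul]; rfl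
    rw [← Nat.pow_le_pow_iff_left two_ne_zero, mul_pow, ← h4, ← h4]
    exact (Nat.mul_le_mul_left _ (Nat.le_succ _)).trans this
  have h2 : ({Y ∈ Z.powerset | ∃ p ∈ E, ∑ i ∈ Y, a i = b p} : Finset (Finset ι)) =
      E.biUnion fun p => {Y ∈ Z.powerset | ∑ i ∈ Y, a i = b p} := by
    ext Y
    simp only [mem_filter, mem_biUnion]
    tauto
  rw [h2, ← smul_eq_mul (#E), ← sum_const]
  refine (Nat.mul_le_mul_right _ card_biUnion_le).trans ?_
  rw [sum_mul]
  exact sum_le_sum fun p _ => h1 p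

theorem link_res_eq (c : Finset ι → G) (U Y : Finset ι) :
    link (res c Y) U = res (link c U) Y := by
  funext S
  rw [link, res, res, link_link, union_comm]

theorem ev_link_res_eq {c : Finset ι → G} {U R Y W : Finset ι} (hU : U ⊆ W) (hR : R ⊆ W \ U)
    (hY : Y ⊆ W \ U) (hRY : Disjoint R Y) (hc : ∀ S ⊆ W, #U + 1 < #S → c S = 0) :
    ev (link (res c Y) U) R = c U + ∑ w ∈ R, c (insert w U) + ∑ w ∈ Y, c (insert w U) := by
  rw [link_res_eq, ← ev_union _ hRY, ev_eq_of_affine, sum_union hRY, add_assoc]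
  · simp only [link, empty_union, insert_eq]
  · intro S hS hS2
    have hSW := hS.trans (union_subset hR hY)
    refine hc _ (union_subset (hSW.trans sdiff_subset) hU) ?_
    rw [card_union_of_disjoint (subset_sdiff.1 hSW).2]
    omega

/-- If the derivatives of order `e` in three disjoint sets of directions are affine and depend on
many variables, the polynomial of degree `e + 1` is rarely zero. -/
theorem le_nz_of_three {c : Finset ι → G} {W U₁ U₂ U₃ : Finset ι} {e : ℕ} (he : 0 < e)
    (hG : NoSmallTorsion G (2 ^ 4 ^ (4 * e + 3))) (hc : ∀ S ⊆ W, e + 1 < #S → c S = 0)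
    (h₁₂ : Disjoint U₁ U₂) (h₁₃ : Disjoint U₁ U₃) (h₂₃ : Disjoint U₂ U₃)
    (hs₁ : U₁ ⊆ W) (hs₂ : U₂ ⊆ W) (hs₃ : U₃ ⊆ W)
    (hc₁ : #U₁ = e) (hc₂ : #U₂ = e) (hc₃ : #U₃ = e)
    (hm : ∀ U ∈ ({U₁, U₂, U₃} : Finset (Finset ι)),
      4 ^ (4 * e + 3) + 3 * e ≤ #{w ∈ W \ U | c (insert w U) ≠ 0}) :
    2 ^ #W ≤ 2 ^ e * nz c W := by
  obtain ⟨u, hu⟩ := card_pos.1 (hc₂ ▸ he)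
  set W₀ := U₁ ∪ U₂ ∪ U₃ with hW₀
  have hW₀W : W₀ ⊆ W := union_subset (union_subset hs₁ hs₂) hs₃
  have ht₁ : U₁ ⊆ W₀ := subset_union_left.trans subset_union_left
  have ht₂ : U₂ ⊆ W₀ := subset_union_right.trans subset_union_left
  have ht₃ : U₃ ⊆ W₀ := subset_union_right
  have hW₀c : #W₀ = 3 * e := by
    rw [hW₀, card_union_of_disjoint (disjoint_union_left.2 ⟨h₁₃, h₂₃⟩),
      card_union_of_disjoint h₁₂]
    omega
  set Z := W \ W₀ with hZ
  have hJ : ∀ U ∈ ({U₁, U₂, U₃} : Finset (Finset ι)),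
      4 ^ (4 * e + 3) ≤ #{w ∈ Z | c (insert w U) ≠ 0} := by
    intro U hU
    have h1 : ({w ∈ W \ U | c (insert w U) ≠ 0} : Finset ι) ⊆
        {w ∈ Z | c (insert w U) ≠ 0} ∪ W₀ := by
      intro w hw
      simp only [mem_filter, mem_union, hZ, mem_sdiff] at hw ⊢
      tauto
    have h2 := (card_le_card h1).trans (card_union_le _ _)
    have h3 := hm U hU
    omega
  have hmem₁ : U₁ ∈ ({U₁, U₂, U₃} : Finset (Finset ι)) := by simp
  have hmem₂ : U₂ ∈ ({U₁, U₂, U₃} : Finset (Finset ι)) := by simp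
  have hmem₃ : U₃ ∈ ({U₁, U₂, U₃} : Finset (Finset ι)) := by simp
  let bad (U : Finset ι) : Finset (Finset ι) := {Y ∈ Z.powerset | ∃ R ∈ (W₀ \ U).powerset,
    ∑ w ∈ Y, c (insert w U) = - (c U + ∑ w ∈ R, c (insert w U))}
  have hbad : ∀ U ∈ ({U₁, U₂, U₃} : Finset (Finset ι)), U ⊆ W₀ → #U = e →
      #(bad U) * 2 ^ (4 * e + 3) ≤ 2 ^ (2 * e) * 2 ^ #Z := by
    intro U hU hUW hUc
    refine (card_exists_sum_eq_mul_le (filter_subset _ Z) (hJ U hU) hG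
      (fun i hi => (mem_filter.1 hi).2) _ _).trans_eq ?_
    rw [card_powerset, card_sdiff_of_subset hUW, hW₀c, hUc]
    congr 2
    omega
  have hG2 : ∀ g : G, g ≠ 0 → 2 • g ≠ 0 := fun g hg =>
    hG g hg 2 two_pos (Nat.le_self_pow (by positivity) 2)
  let bad' : Finset (Finset ι) := {Y ∈ Z.powerset | ∃ p ∈ U₃.powerset ×ˢ U₃.powerset,
    ∑ w ∈ Y, 2 • c (insert w U₁) = ∑ w ∈ p.1, c (insert w U₂) - ∑ w ∈ p.2, c (insert w U₂) -
      ∑ w ∈ p.1, c (insert w U₁) - ∑ w ∈ insert u p.2, c (insert w U₁) - 2 • c U₁}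
  have hbad' : #bad' * 2 ^ (4 * e + 3) ≤ 2 ^ (2 * e) * 2 ^ #Z := by
    refine (card_exists_sum_eq_mul_le (filter_subset _ Z) (hJ U₁ hmem₁) hG
      (fun i hi => hG2 _ (mem_filter.1 hi).2) _ _).trans_eq ?_
    rw [card_product, card_powerset, hc₃, ← pow_add, two_mul]
  set B := bad U₁ ∪ bad U₂ ∪ bad U₃ ∪ bad' with hB
  have hBc : #B * (2 ^ (2 * e) + 1) ≤ 2 ^ #Z := by
    have h1 := hbad U₁ hmem₁ ht₁ hc₁
    have h2 := hbad U₂ hmem₂ ht₂ hc₂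
    have h3 := hbad U₃ hmem₃ ht₃ hc₃
    have h4 : #B ≤ #(bad U₁) + #(bad U₂) + #(bad U₃) + #bad' :=
      (card_union_le _ _).trans (Nat.add_le_add_right ((card_union_le _ _).trans
        (Nat.add_le_add_right (card_union_le _ _) _)) _)
    have h5 : 2 ^ (4 * e + 3) = 2 ^ (2 * e) * (8 * 2 ^ (2 * e)) := by
      rw [show 4 * e + 3 = 2 * e + (3 + 2 * e) by ring, pow_add, pow_add]
      norm_num
    have h6 : 1 ≤ 2 ^ (2 * e) := Nat.one_le_two_pow
    have h7 : #B * 2 ^ (4 * e + 3) ≤ 4 * (2 ^ (2 * e) * 2 ^ #Z) := by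
      have := Nat.mul_le_mul_right (2 ^ (4 * e + 3)) h4
      linarith
    rw [h5] at h7
    generalize 2 ^ (2 * e) = q at *
    have h8 : q * (#B * (8 * q)) ≤ q * (4 * 2 ^ #Z) := by linarith
    have h9 := Nat.le_of_mul_le_mul_left h8 h6
    have h10 : #B * 1 ≤ #B * q := Nat.mul_le_mul_left _ h6
    linarith
  have hgood : ∀ Y ∈ Z.powerset, Y ∉ B → 2 ^ (2 * e) + 1 ≤ nz (res c Y) W₀ := by
    intro Y hY hYB
    have hYZ := mem_powerset.1 hY
    by_contra! hlt
    simp only [hB, mem_union, not_or] at hYB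
    obtain ⟨⟨⟨hY₁, hY₂⟩, hY₃⟩, hY'⟩ := hYB
    have hev : ∀ U R : Finset ι, #U = e → U ⊆ W₀ → R ⊆ W₀ \ U → ev (link (res c Y) U) R =
        c U + ∑ w ∈ R, c (insert w U) + ∑ w ∈ Y, c (insert w U) := by
      intro U R hUc hU hR
      refine ev_link_res_eq (hU.trans hW₀W) (hR.trans (sdiff_subset_sdiff hW₀W le_rfl))
        (hYZ.trans (sdiff_subset_sdiff le_rfl hU)) ?_ (by rwa [hUc])
      exact disjoint_of_subset_left (hR.trans sdiff_subset)
        (disjoint_of_subset_right hYZ disjoint_sdiff)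
    have hpos : ∀ U : Finset ι, #U = e → U ⊆ W₀ → Y ∉ bad U →
        ∀ R ⊆ W₀ \ U, ev (link (res c Y) U) R ≠ 0 := by
      intro U hUc hU hYU R hR h0
      rw [hev U R hUc hU hR, add_comm, ← eq_neg_iff_add_eq_zero] at h0
      exact hYU (mem_filter.2 ⟨hY, R, mem_powerset.2 hR, h0⟩)
    obtain ⟨X, hX, X', hX', e1, e2⟩ := exists_of_nz_le h₁₂ h₁₃ h₂₃ hc₁ hc₂ hc₃ hu
      (hpos U₁ hc₁ ht₁ hY₁) (hpos U₂ hc₂ ht₂ hY₂) (hpos U₃ hc₃ ht₃ hY₃) (Nat.lt_succ_iff.1 hlt)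
    have hsub₁ : ∀ R ⊆ U₃, R ⊆ W₀ \ U₁ := fun R hR => subset_sdiff.2
      ⟨hR.trans ht₃, disjoint_of_subset_left hR h₁₃.symm⟩
    have hsub₂ : ∀ R ⊆ U₃, R ⊆ W₀ \ U₂ := fun R hR => subset_sdiff.2
      ⟨hR.trans ht₃, disjoint_of_subset_left hR h₂₃.symm⟩
    have huX' : insert u X' ⊆ W₀ \ U₁ := insert_subset
      (mem_sdiff.2 ⟨ht₂ hu, disjoint_right.1 h₁₂ hu⟩) (hsub₁ X' hX')
    rw [hev U₁ X hc₁ ht₁ (hsub₁ X hX), hev U₂ X hc₂ ht₂ (hsub₂ X hX)] at e1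
    rw [hev U₁ _ hc₁ ht₁ huX', hev U₂ X' hc₂ ht₂ (hsub₂ X' hX')] at e2
    refine hY' (mem_filter.2 ⟨hY, (X, X'), mem_product.2
      ⟨mem_powerset.2 hX, mem_powerset.2 hX'⟩, ?_⟩)
    rw [← smul_sum, two_smul, two_smul]
    dsimp only
    generalize ∑ w ∈ insert u X', c (insert w U₁) = a₁ at *
    generalize ∑ w ∈ X, c (insert w U₁) = a₂ at *
    generalize ∑ w ∈ X, c (insert w U₂) = a₃ at *
    generalize ∑ w ∈ X', c (insert w U₂) = a₄ at *
    generalize ∑ w ∈ Y, c (insert w U₁) = a₅ at *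
    generalize ∑ w ∈ Y, c (insert w U₂) = a₆ at *
    have h5 : a₅ = c U₂ + a₃ + a₆ - c U₁ - a₂ := by rw [← e1]; abel
    have h6 : a₅ = -(c U₂ + a₄ + a₆) - c U₁ - a₁ := by rw [← e2]; abel
    nth_rewrite 1 [h5]
    rw [h6]
    abel
  have hcount : (2 ^ #Z - #B) * (2 ^ (2 * e) + 1) ≤ nz c W := by
    rw [nz_eq_sum_res c hW₀W, ← card_powerset]
    have hBZ : B ⊆ Z.powerset := by
      simp only [hB, union_subset_iff]
      exact ⟨⟨⟨filter_subset _ _, filter_subset _ _⟩, filter_subset _ _⟩, filter_subset _ _⟩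
    rw [← card_sdiff_of_subset hBZ, ← smul_eq_mul, ← sum_const]
    refine (sum_le_sum fun Y hY => ?_).trans (sum_le_sum_of_subset sdiff_subset)
    exact hgood Y (mem_sdiff.1 hY).1 (mem_sdiff.1 hY).2
  have hWc : #W = #Z + 3 * e := by
    have := card_sdiff_add_card_eq_card hW₀W
    rw [← hZ, hW₀c] at this
    exact this.symm
  rw [Nat.sub_mul] at hcount
  have hfin : 2 ^ #Z * 2 ^ (2 * e) ≤ nz c W := by
    have : 2 ^ #Z * (2 ^ (2 * e) + 1) = 2 ^ #Z * 2 ^ (2 * e) + 2 ^ #Z := by ring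
    omega
  calc 2 ^ #W = 2 ^ e * (2 ^ #Z * 2 ^ (2 * e)) := by rw [hWc]; ring
    _ ≤ _ := Nat.mul_le_mul_left _ hfin

end Gain

section Covers

/-- A family of nonempty sets of size at most `r` has `t` disjoint members or a cover of size at
most `r * t`. -/
theorem exists_disjoint_or_cover {ι : Type*} [DecidableEq ι] {F : Finset (Finset ι)} {r : ℕ}
    (hne : ∀ T ∈ F, T.Nonempty) (hr : ∀ T ∈ F, #T ≤ r) (t : ℕ) :
    (∃ M ⊆ F, #M = t ∧ (M : Set (Finset ι)).PairwiseDisjoint id) ∨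
      ∃ C : Finset ι, #C ≤ r * t ∧ ∀ T ∈ F, ¬ Disjoint T C := by
  induction t with
  | zero => exact Or.inl ⟨∅, empty_subset _, rfl, by simp⟩
  | succ t ih =>
    obtain ⟨M, hMF, hM, hd⟩ | ⟨C, hC, hcov⟩ := ih
    · by_cases h : ∃ T ∈ F, ∀ S ∈ M, Disjoint T S
      · obtain ⟨T, hT, hTM⟩ := h
        have hTn : T ∉ M := fun hTm => (hne T hT).ne_empty (disjoint_self.1 (hTM T hTm))
        refine Or.inl ⟨insert T M, insert_subset hT hMF, by rw [card_insert_of_notMem hTn, hM], ?_⟩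
        rw [coe_insert, Set.pairwiseDisjoint_insert_of_notMem (by simpa using hTn)]
        exact ⟨hd, hTM⟩
      · push Not at h
        refine Or.inr ⟨M.biUnion id, ?_, fun T hT hdis => ?_⟩
        · calc #(M.biUnion id) ≤ #M * r := card_biUnion_le_card_mul _ _ _ fun T hT => hr T (hMF hT)
            _ ≤ r * (t + 1) := by rw [hM, mul_comm]; exact Nat.mul_le_mul_left _ (Nat.le_succ t)
        · obtain ⟨S, hS, hTS⟩ := h T hT
          exact hTS (disjoint_of_subset_right (subset_biUnion_of_mem id hS) hdis)
    · exact Or.inr ⟨C, hC.trans (Nat.mul_le_mul_left _ (Nat.le_succ t)), hcov⟩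

theorem card_filter_not_disjoint_le {ι : Type*} [DecidableEq ι] {M : Finset (Finset ι)}
    (hM : (M : Set (Finset ι)).PairwiseDisjoint id) (C : Finset ι) :
    #{T ∈ M | ¬ Disjoint T C} ≤ #C := by
  have h : ∀ T ∈ ({T ∈ M | ¬ Disjoint T C} : Finset _), ∃ x ∈ C, x ∈ T := by
    intro T hT
    obtain ⟨x, hxT, hxC⟩ := not_disjoint_iff.1 (mem_filter.1 hT).2
    exact ⟨x, hxC, hxT⟩
  refine card_le_card_of_forall_subsingleton (fun T x => x ∈ T) h ?_
  intro x _ T hT T' hT'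
  by_contra hne
  exact disjoint_left.1 (hM (mem_filter.1 hT.1).1 (mem_filter.1 hT'.1).1 hne) hT.2 hT'.2

/-- A directed graph with small out-degrees has a large independent set. -/
theorem exists_independent {α : Type*} [DecidableEq α] (N : α → Finset α) (D : ℕ) (k : ℕ)
    (V : Finset α) (hN : ∀ i ∈ V, #{j ∈ V | j ∈ N i} ≤ D) (hV : k * (2 * D + 1) ≤ #V) :
    ∃ I ⊆ V, #I = k ∧ ∀ i ∈ I, ∀ j ∈ I, i ≠ j → j ∉ N i := by
  induction k generalizing V with
  | zero => exact ⟨∅, empty_subset _, rfl, by simp⟩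
  | succ k ih =>
    have hpos : V.Nonempty := card_pos.1 (by nlinarith)
    have hin : ∃ v ∈ V, #{i ∈ V | v ∈ N i} ≤ D := by
      refine exists_le_of_sum_le hpos ?_
      exact (sum_card_bipartiteAbove_eq_sum_card_bipartiteBelow fun i j => j ∈ N i).symm.trans_le
        (sum_le_sum hN)
    obtain ⟨v, hv, hvD⟩ := hin
    set B : Finset α := insert v (({i ∈ V | v ∈ N i} : Finset α) ∪ {j ∈ V | j ∈ N v}) with hB
    have hBc : #B ≤ 2 * D + 1 := by
      have h1 := card_insert_le v (({i ∈ V | v ∈ N i} : Finset α) ∪ {j ∈ V | j ∈ N v})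
      have h2 := card_union_le ({i ∈ V | v ∈ N i} : Finset α) {j ∈ V | j ∈ N v}
      have h3 := hN v hv
      rw [← hB] at h1
      omega
    have hV' : k * (2 * D + 1) ≤ #(V \ B) := by
      have := le_card_sdiff B V
      have : (k + 1) * (2 * D + 1) = k * (2 * D + 1) + (2 * D + 1) := by ring
      omega
    obtain ⟨I, hI, hIk, hind⟩ := ih (V \ B)
      (fun i hi => (card_le_card (filter_subset_filter _ sdiff_subset)).trans
        (hN i (mem_sdiff.1 hi).1)) hV'
    have hIV : ∀ i ∈ I, i ∈ V ∧ i ≠ v ∧ v ∉ N i ∧ i ∉ N v := by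
      intro i hi
      have := hI hi
      simp only [hB, mem_sdiff, mem_insert, mem_union, mem_filter, not_or, not_and] at this
      exact ⟨this.1, this.2.1, this.2.2.1 this.1, this.2.2.2 this.1⟩
    have hvI : v ∉ I := fun h => (hIV v h).2.1 rfl
    refine ⟨insert v I, insert_subset hv (hI.trans sdiff_subset),
      by rw [card_insert_of_notMem hvI, hIk], ?_⟩
    intro i hi j hj hij
    rw [mem_insert] at hi hj
    obtain rfl | hi := hi
    · obtain rfl | hj := hj
      · exact absurd rfl hij
      · exact (hIV j hj).2.2.2
    · obtain rfl | hj := hj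
      · exact (hIV i hi).2.2.1
      · exact hind i hi j hj hij

end Covers

section DisjointMonomials

variable {ι : Type*} [DecidableEq ι] {G : Type*} [AddCommGroup G]

theorem res_eq_of_le_card {c : Finset ι → G} {d : ℕ} {W T Y : Finset ι}
    (hc : ∀ S ⊆ W, d < #S → c S = 0) (hT : T ⊆ W) (hY : Y ⊆ W) (hTY : Disjoint Y T)
    (hd : d ≤ #T) : res c Y T = c T := by
  rw [res, ev, sum_eq_single_of_mem ∅ (empty_mem_powerset _)]
  · simp [link]
  · intro R hR hne
    rw [mem_powerset] at hR
    refine hc _ (union_subset (hR.trans hY) hT) ?_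
    rw [card_union_of_disjoint (disjoint_of_subset_left hR hTY)]
    have := card_pos.2 (nonempty_iff_ne_empty.2 hne)
    omega

/-- The monomials of degree `d` divisible by `U`, with `U` removed. -/
noncomputable def topLink (c : Finset ι → G) (d : ℕ) (W U : Finset ι) : Finset (Finset ι) :=
  {T ∈ (W \ U).powerset | #T + #U = d ∧ link c U T ≠ 0}

theorem le_nz_of_covers {c : Finset ι → G} {d D : ℕ} {W : Finset ι} {M : Finset (Finset ι)}
    (hd : 2 ≤ d) (hG : NoSmallTorsion G 16) (hc : ∀ S ⊆ W, d < #S → c S = 0)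
    (hM : ∀ S ∈ M, S ⊆ W ∧ #S = d ∧ c S ≠ 0) (hdis : (M : Set (Finset ι)).PairwiseDisjoint id)
    (C : Finset ι → Finset ι) (hD : ∀ S ∈ M, #(C S) ≤ D)
    (hcov : ∀ S ∈ M, ∀ U ⊂ S, U.Nonempty → ∀ T ∈ topLink c d W U, ¬ Disjoint T (C S))
    (hcard : 4 * (2 * D + 1) ≤ #M) :
    2 ^ #W ≤ 2 ^ (d - 1) * nz c W := by
  obtain ⟨I, hIM, hI4, hind⟩ := exists_independent (fun S => {T ∈ M | ¬ Disjoint T (C S)}) D 4 M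
    (fun S hS => (card_le_card fun T hT => (mem_filter.1 hT).2).trans
      ((card_filter_not_disjoint_le hdis _).trans (hD S hS))) hcard
  obtain ⟨E⟩ : Nonempty (Fin 4 ≃ I) := ⟨(I.equivFinOfCardEq hI4).symm⟩
  set S : Fin 4 → Finset ι := fun i => E i with hS
  have hSI : ∀ i, S i ∈ I := fun i => (E i).2
  have hSM : ∀ i, S i ∈ M := fun i => hIM (hSI i)
  have hSinj : ∀ i j, i ≠ j → S i ≠ S j := fun i j hij h => hij (E.injective (Subtype.ext h))
  set W' := univ.biUnion S with hW'
  have hW'W : W' ⊆ W := biUnion_subset.2 fun i _ => (hM _ (hSM i)).1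
  have hfib : ∀ Y ∈ (W \ W').powerset, 2 ^ #W' ≤ 2 ^ (d - 1) * nz (res c Y) W' := by
    intro Y hY
    rw [mem_powerset] at hY
    have hres : ∀ T ⊆ W', d ≤ #T → res c Y T = c T := fun T hT hdT =>
      res_eq_of_le_card hc (hT.trans hW'W) (hY.trans sdiff_subset)
        (disjoint_of_subset_right hT (subset_sdiff.1 hY).2) hdT
    have hSW' : ∀ i, S i ⊆ W' := fun i => subset_biUnion_of_mem S (mem_univ i)
    refine IsMatching.le_nz hG hd ⟨fun i => (hM _ (hSM i)).2.1,
      fun i j hij => hdis (hSM i) (hSM j) (hSinj i j hij), fun i => ?_, fun T hT hdT hne => ?_⟩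
    · rw [hres _ (hSW' i) (hM _ (hSM i)).2.1.ge]
      exact (hM _ (hSM i)).2.2
    · rw [hres T hT hdT]
      by_contra hcT
      have hTd : #T = d := by
        by_contra h
        exact hcT (hc T (hT.trans hW'W) (by omega))
      obtain ⟨x, hx⟩ := card_pos.1 (show 0 < #T by omega)
      obtain ⟨i, -, hxi⟩ := mem_biUnion.1 (hT hx)
      have hss : T ∩ S i ⊂ S i := by
        refine inter_subset_right.ssubset_of_ne fun h => hne i ?_
        have h1 : S i ⊆ T := h ▸ inter_subset_left
        exact (eq_of_subset_of_card_le h1 (by rw [hTd, (hM _ (hSM i)).2.1])).symm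
      have hmem : T \ (T ∩ S i) ∈ topLink c d W (T ∩ S i) := by
        refine mem_filter.2 ⟨mem_powerset.2 (sdiff_subset_sdiff (hT.trans hW'W) le_rfl), ?_, ?_⟩
        · rw [card_sdiff_add_card_eq_card inter_subset_left, hTd]
        · rwa [link, sdiff_union_of_subset inter_subset_left]
      obtain ⟨y, hy, hyC⟩ := not_disjoint_iff.1
        (hcov _ (hSM i) _ hss ⟨x, mem_inter.2 ⟨hx, hxi⟩⟩ _ hmem)
      rw [mem_sdiff, mem_inter] at hy
      obtain ⟨j, -, hyj⟩ := mem_biUnion.1 (hT hy.1)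
      have hij : i ≠ j := by
        rintro rfl
        exact hy.2 ⟨hy.1, hyj⟩
      exact hind _ (hSI i) _ (hSI j) (hSinj i j hij)
        (mem_filter.2 ⟨hSM j, not_disjoint_iff.2 ⟨y, hyj, hyC⟩⟩)
  have hsum := sum_le_sum hfib
  rw [sum_const, ← mul_sum, ← nz_eq_sum_res c hW'W, card_powerset, smul_eq_mul, ← pow_add,
    card_sdiff_add_card_eq_card hW'W] at hsum
  exact hsum

theorem two_pow_bound (f : ℕ) :
    4 * (2 * (2 ^ (f + 2) * ((f + 2) * 2 ^ (10 * (f + 1) ^ 2) + 2 ^ (8 * (f + 2)))) + 1) + 2 ≤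
      2 ^ (10 * (f + 2) ^ 2) := by
  have h1 : f + 2 ≤ 2 ^ (f + 2) := Nat.lt_two_pow_self.le
  have h2 : (f + 2) * 2 ^ (10 * (f + 1) ^ 2) ≤ 2 ^ (10 * f ^ 2 + 21 * f + 16) := by
    refine (Nat.mul_le_mul_right _ h1).trans ?_
    rw [← pow_add]
    exact Nat.pow_le_pow_right two_pos (by nlinarith)
  have h3 : 2 ^ (8 * (f + 2)) ≤ 2 ^ (10 * f ^ 2 + 21 * f + 16) :=
    Nat.pow_le_pow_right two_pos (by nlinarith)
  have h4 : 2 ^ (10 * f ^ 2 + 22 * f + 23) ≤ 2 ^ (10 * (f + 2) ^ 2) :=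
    Nat.pow_le_pow_right two_pos (by nlinarith)
  have h5 : 2 ^ (10 * f ^ 2 + 22 * f + 23) =
      32 * (2 ^ (f + 2) * 2 ^ (10 * f ^ 2 + 21 * f + 16)) := by
    rw [← pow_add, show (32 : ℕ) = 2 ^ 5 by norm_num, ← pow_add]
    congr 1
    ring
  have h6 : 1 ≤ 2 ^ (f + 2) * 2 ^ (10 * f ^ 2 + 21 * f + 16) := Nat.succ_le_of_lt (by positivity)
  have h7 := Nat.mul_le_mul_left (2 ^ (f + 2)) (add_le_add h2 h3)
  rw [← two_mul, mul_left_comm] at h7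
  omega

theorem four_pow_add_le (f : ℕ) : 4 ^ (4 * (f + 1) + 3) + 3 * (f + 1) ≤ 2 ^ (8 * (f + 2)) := by
  have h1 : f < 2 ^ f := Nat.lt_two_pow_self
  have h2 : 2 ^ f ≤ 2 ^ (8 * f + 14) := Nat.pow_le_pow_right two_pos (by omega)
  have h3 : 4 ^ (4 * (f + 1) + 3) = 2 ^ (8 * f + 14) := by
    rw [show (4 : ℕ) = 2 ^ 2 by norm_num, ← pow_mul]
    congr 1
    ring
  have h4 : 2 ^ (8 * (f + 2)) = 4 * 2 ^ (8 * f + 14) := by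
    rw [show 8 * (f + 2) = 2 + (8 * f + 14) by ring, pow_add]
    norm_num
  omega

/-- A polynomial of degree `d` with many disjoint monomials of degree `d` is nonzero with
probability at least `2 ^ (-(d - 1))`. -/
theorem le_nz_of_disjoint {d : ℕ} (hd : 2 ≤ d) (hG : NoSmallTorsion G (2 ^ 2 ^ (8 * d)))
    {c : Finset ι → G} {W : Finset ι} (hc : ∀ S ⊆ W, d < #S → c S = 0) {M : Finset (Finset ι)}
    (hM : ∀ S ∈ M, S ⊆ W ∧ #S = d ∧ c S ≠ 0) (hdis : (M : Set (Finset ι)).PairwiseDisjoint id)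
    (hcard : 2 ^ (10 * d ^ 2) ≤ #M) :
    2 ^ #W ≤ 2 ^ (d - 1) * nz c W := by
  induction d using Nat.strong_induction_on generalizing c W M with
  | _ d ih =>
  obtain ⟨f, rfl⟩ : ∃ f, d = f + 2 := ⟨d - 2, by omega⟩
  have h4 : ∀ m : ℕ, 4 ^ m = 2 ^ (2 * m) := fun m => by rw [pow_mul]; rfl
  by_cases hA : ∃ S ∈ M, ∃ U ⊆ S, U.Nonempty ∧ #U ≤ f ∧
      ∃ M' ⊆ topLink c (f + 2) W U, #M' = 2 ^ (10 * (f + 2 - #U) ^ 2) ∧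
        (M' : Set (Finset ι)).PairwiseDisjoint id
  · obtain ⟨S, hS, U, hUS, hU, hUf, M', hM', hM'c, hM'd⟩ := hA
    have hUW := hUS.trans (hM S hS).1
    have hU0 := card_pos.2 hU
    have h1 : 2 ^ #(W \ U) ≤ 2 ^ (f + 2 - #U - 1) * nz (link c U) (W \ U) := by
      refine ih (f + 2 - #U) (by omega) (by omega) (hG.mono ?_) ?_ ?_ hM'd hM'c.ge
      · exact Nat.pow_le_pow_right two_pos (Nat.pow_le_pow_right two_pos (by omega))
      · intro T hT hTc
        refine hc _ (union_subset (hT.trans sdiff_subset) hUW) ?_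
        rw [card_union_of_disjoint (subset_sdiff.1 hT).2]
        omega
      · intro T hT
        obtain ⟨h1, h2, h3⟩ := mem_filter.1 (hM' hT)
        exact ⟨mem_powerset.1 h1, by omega, h3⟩
    have h2 : #W = #U + #(W \ U) := by rw [add_comm, card_sdiff_add_card_eq_card hUW]
    have h3 : f + 2 - 1 = #U + (f + 2 - #U - 1) := by omega
    rw [h2, h3, pow_add, pow_add, mul_assoc]
    exact Nat.mul_le_mul_left _ (h1.trans (Nat.mul_le_mul_left _ (nz_link_le c hUW)))
  · set m := 4 ^ (4 * (f + 1) + 3) + 3 * (f + 1) with hm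
    let bad : Finset ι → Prop := fun S =>
      ∃ U ⊆ S, #U = f + 1 ∧ m ≤ #{w ∈ W \ U | c (insert w U) ≠ 0}
    by_cases hB : 2 < #{S ∈ M | bad S}
    · obtain ⟨S₁, S₂, S₃, h₁, h₂, h₃, h₁₂, h₁₃, h₂₃⟩ := two_lt_card_iff.1 hB
      obtain ⟨hS₁, U₁, hU₁, hc₁, hm₁⟩ := mem_filter.1 h₁
      obtain ⟨hS₂, U₂, hU₂, hc₂, hm₂⟩ := mem_filter.1 h₂
      obtain ⟨hS₃, U₃, hU₃, hc₃, hm₃⟩ := mem_filter.1 h₃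
      have hdis' : ∀ {S T U V : Finset ι}, S ∈ M → T ∈ M → S ≠ T → U ⊆ S → V ⊆ T →
          Disjoint U V := fun hS hT hne hUS hVT =>
        disjoint_of_subset_left hUS (disjoint_of_subset_right hVT (hdis hS hT hne))
      refine le_nz_of_three (e := f + 1) (Nat.succ_pos f) (hG.mono ?_) hc
        (hdis' hS₁ hS₂ h₁₂ hU₁ hU₂) (hdis' hS₁ hS₃ h₁₃ hU₁ hU₃) (hdis' hS₂ hS₃ h₂₃ hU₂ hU₃)
        (hU₁.trans (hM _ hS₁).1) (hU₂.trans (hM _ hS₂).1) (hU₃.trans (hM _ hS₃).1) hc₁ hc₂ hc₃ ?_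
      · rw [h4]
        exact Nat.pow_le_pow_right two_pos (Nat.pow_le_pow_right two_pos (by omega))
      · intro U hU
        simp only [mem_insert, mem_singleton] at hU
        obtain rfl | rfl | rfl := hU
        · exact hm₁
        · exact hm₂
        · exact hm₃
    · set M₀ := ({S ∈ M | ¬ bad S} : Finset (Finset ι)) with hM₀
      set k := (f + 2) * 2 ^ (10 * (f + 1) ^ 2) + 2 ^ (8 * (f + 2)) with hk
      have hex : ∀ S ∈ M₀, ∀ U ⊂ S, U.Nonempty → ∃ C : Finset ι, #C ≤ k ∧
          ∀ T ∈ topLink c (f + 2) W U, ¬ Disjoint T C := by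
        intro S hS U hUS hU
        obtain ⟨hSM, hbad⟩ := mem_filter.1 hS
        have hUc := card_lt_card hUS
        rw [(hM S hSM).2.1] at hUc
        have hU0 := card_pos.2 hU
        by_cases hUf : #U ≤ f
        · obtain ⟨M', hM', hM'c, hM'd⟩ | ⟨C, hC, hcov⟩ :=
            exists_disjoint_or_cover (F := topLink c (f + 2) W U) (r := f + 2)
              (fun T hT => card_pos.1 (by have := (mem_filter.1 hT).2.1; omega))
              (fun T hT => by have := (mem_filter.1 hT).2.1; omega) (2 ^ (10 * (f + 2 - #U) ^ 2))
          · exact absurd ⟨S, hSM, U, hUS.1, hU, hUf, M', hM', hM'c, hM'd⟩ hA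
          · refine ⟨C, hC.trans (le_trans ?_ (Nat.le_add_right _ _)), hcov⟩
            refine Nat.mul_le_mul_left _ (Nat.pow_le_pow_right two_pos (Nat.mul_le_mul_left _ ?_))
            exact Nat.pow_le_pow_left (by omega) 2
        · have hUc' : #U = f + 1 := by omega
          refine ⟨({w ∈ W \ U | c (insert w U) ≠ 0} : Finset ι), ?_, ?_⟩
          · refine le_trans (le_of_lt ?_)
              ((four_pow_add_le f).trans (Nat.le_add_left _ _))
            by_contra! h
            exact hbad ⟨U, hUS.1, hUc', h⟩
          · intro T hT
            obtain ⟨hTW, hTc, hTl⟩ := mem_filter.1 hT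
            rw [hUc'] at hTc
            obtain ⟨w, rfl⟩ := card_eq_one.1 (show #T = 1 by omega)
            rw [disjoint_singleton_left, not_not, mem_filter]
            exact ⟨singleton_subset_iff.1 (mem_powerset.1 hTW), by rwa [insert_eq]⟩
      choose! C hC hcov using hex
      refine le_nz_of_covers (M := M₀) hd (hG.mono ?_) hc (fun S hS => hM S (mem_filter.1 hS).1)
        (hdis.subset (coe_subset.2 (filter_subset _ _)))
        (fun S => S.ssubsets.biUnion fun U => if U.Nonempty then C S U else ∅)
        (D := 2 ^ (f + 2) * k) ?_ ?_ ?_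
      · calc 16 = 2 ^ 2 ^ 2 := by norm_num
          _ ≤ _ := Nat.pow_le_pow_right two_pos (Nat.pow_le_pow_right two_pos (by omega))
      · intro S hS
        refine (card_biUnion_le_card_mul _ _ k ?_).trans (Nat.mul_le_mul_right _ ?_)
        · intro U hU
          split_ifs with h
          · exact hC S hS U (mem_ssubsets.1 hU) h
          · simp
        · rw [← (hM S (mem_filter.1 hS).1).2.1, ← card_powerset]
          exact card_le_card (erase_subset _ _)
      · intro S hS U hUS hU T hT hdT
        refine hcov S hS U hUS hU T hT (disjoint_of_subset_right ?_ hdT)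
        intro x hx
        exact mem_biUnion.2 ⟨U, mem_ssubsets.2 hUS, by rwa [if_pos hU]⟩
      · have h1 : #{S ∈ M | bad S} + #M₀ = #M := by
          convert card_filter_add_card_filter_not (s := M) bad
        have h2 := two_pow_bound f
        rw [← hk] at h2
        omega

end DisjointMonomials

section Main

variable {ι : Type*} [DecidableEq ι] {G : Type*} [AddCommGroup G]

theorem le_nz_of_affine {c : Finset ι → G} {s : ℕ} {W : Finset ι} (hs : 0 < s)
    (hG : NoSmallTorsion G (2 ^ s)) (hc : ∀ S ⊆ W, 1 < #S → c S = 0)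
    (hcard : s ≤ #{S ∈ W.powerset | c S ≠ 0}) :
    (1 - 1 / √(s : ℝ)) * 2 ^ #W ≤ nz c W := by
  set J : Finset ι := {x ∈ W | c {x} ≠ 0} with hJ
  have hsJ : s ≤ #J + 1 := by
    have h1 : ({S ∈ W.powerset | c S ≠ 0} : Finset (Finset ι)) ⊆ insert ∅ (J.image singleton) := by
      intro S hS
      obtain ⟨hSW, hSc⟩ := mem_filter.1 hS
      rw [mem_powerset] at hSW
      obtain h0 | h1 : #S = 0 ∨ #S = 1 := by
        have := mt (hc S hSW) hSc
        omega
      · exact mem_insert.2 (Or.inl (card_eq_zero.1 h0))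
      · obtain ⟨x, rfl⟩ := card_eq_one.1 h1
        exact mem_insert_of_mem (mem_image_of_mem _
          (mem_filter.2 ⟨singleton_subset_iff.1 hSW, hSc⟩))
    exact hcard.trans ((card_le_card h1).trans ((card_insert_le _ _).trans
      (Nat.add_le_add_right card_image_le 1)))
  obtain ⟨J', hJ'J, hJ'⟩ := exists_subset_card_eq (show s - 1 ≤ #J by omega)
  have hLO := card_sum_eq_sq_mul_le (hJ'J.trans (filter_subset _ W))
    (hG.mono (Nat.pow_le_pow_right two_pos (by omega)))
    (fun i hi => (mem_filter.1 (hJ'J hi)).2) (- c ∅)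
  have htot := nz_add_sum_of_affine hc
  rw [hJ', Nat.sub_add_cancel hs] at hLO
  generalize ∑ X ∈ W.powerset, (if ∑ x ∈ X, c {x} = - c ∅ then 1 else 0) = z at hLO htot
  have hs0 : 0 < √(s : ℝ) := Real.sqrt_pos.2 (by exact_mod_cast hs)
  have hz : z * √(s : ℝ) ≤ 2 ^ #W := by
    refine le_of_sq_le_sq ?_ (by positivity)
    rw [mul_pow, Real.sq_sqrt (Nat.cast_nonneg s), ← pow_mul, mul_comm (#W), pow_mul]
    norm_num
    exact_mod_cast hLO
  have htot' : (nz c W : ℝ) + z = 2 ^ #W := by exact_mod_cast htot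
  have hz' : (z : ℝ) ≤ 1 / √(s : ℝ) * 2 ^ #W := by
    rw [one_div_mul_eq_div, le_div_iff₀ hs0]
    exact hz
  linarith

theorem le_nz_of_maximal {c : Finset ι → G} {S W : Finset ι} (hS : S ⊆ W) (hcS : c S ≠ 0)
    (hmax : ∀ T ⊆ W, S ⊂ T → c T = 0) : 2 ^ #W ≤ 2 ^ #S * nz c W := by
  have h1 : nz (link c S) (W \ S) = 2 ^ #(W \ S) := by
    rw [nz, ← card_powerset, card_eq_sum_ones]
    refine sum_congr rfl fun X hX => if_pos ?_
    have hXS := subset_sdiff.1 (mem_powerset.1 hX)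
    rw [ev, sum_eq_single_of_mem ∅ (empty_mem_powerset _)]
    · rwa [link, empty_union]
    · intro R hR hne
      rw [mem_powerset] at hR
      refine hmax _ (union_subset (hR.trans hXS.1) hS) (subset_union_right.ssubset_of_ne fun h => ?_)
      exact hne (disjoint_self.1 (disjoint_of_subset_right (h ▸ subset_union_left)
        (disjoint_of_subset_left hR hXS.2)))
  have h2 := nz_link_le c hS
  rw [h1] at h2
  rw [← card_sdiff_add_card_eq_card hS, add_comm, pow_add]
  exact Nat.mul_le_mul_left _ h2

theorem exists_card_le_mul_of_cover {F : Finset (Finset ι)} {C : Finset ι} (hF : F.Nonempty)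
    (hC : ∀ T ∈ F, ¬ Disjoint T C) : ∃ v ∈ C, #F ≤ #C * #{T ∈ F | v ∈ T} := by
  have hsub : F ⊆ C.biUnion fun v => {T ∈ F | v ∈ T} := by
    intro T hT
    obtain ⟨v, hvT, hvC⟩ := not_disjoint_iff.1 (hC T hT)
    exact mem_biUnion.2 ⟨v, hvC, mem_filter.2 ⟨hT, hvT⟩⟩
  have hCne : C.Nonempty := by
    obtain ⟨T, hT⟩ := hF
    obtain ⟨v, -, hvC⟩ := not_disjoint_iff.1 (hC T hT)
    exact ⟨v, hvC⟩
  refine exists_le_of_sum_le hCne ?_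
  rw [sum_const, ← mul_sum, smul_eq_mul]
  exact Nat.mul_le_mul_left _ ((card_le_card hsub).trans card_biUnion_le)

theorem card_le_of_not_maximal {c : Finset ι → G} {d : ℕ} {W : Finset ι}
    (hc : ∀ S ⊆ W, d < #S → c S = 0)
    (hmax : ∀ S ⊆ W, #S < d → c S ≠ 0 → ∃ T ⊆ W, S ⊂ T ∧ c T ≠ 0) :
    #{S ∈ W.powerset | c S ≠ 0} ≤ #{T ∈ W.powerset | #T = d ∧ c T ≠ 0} * 2 ^ d := by
  have hsub : ({S ∈ W.powerset | c S ≠ 0} : Finset (Finset ι)) ⊆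
      ({T ∈ W.powerset | #T = d ∧ c T ≠ 0} : Finset (Finset ι)).biUnion powerset := by
    intro S hS
    obtain ⟨T, hT, hTmax⟩ := exists_max_image ({T ∈ W.powerset | S ⊆ T ∧ c T ≠ 0} : Finset _) card
      ⟨S, by simpa using hS⟩
    obtain ⟨hTW, hST, hTc⟩ := mem_filter.1 hT
    rw [mem_powerset] at hTW
    refine mem_biUnion.2 ⟨T, mem_filter.2 ⟨mem_powerset.2 hTW, ?_, hTc⟩, mem_powerset.2 hST⟩
    obtain h | h | h := lt_trichotomy #T d
    · obtain ⟨T', hT'W, hTT', hT'c⟩ := hmax T hTW h hTc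
      have := hTmax T' (mem_filter.2 ⟨mem_powerset.2 hT'W, hST.trans hTT'.1, hT'c⟩)
      exact absurd (card_lt_card hTT') this.not_gt
    · exact h
    · exact absurd (hc T hTW h) hTc
  refine (card_le_card hsub).trans (card_biUnion_le_card_mul _ _ _ fun T hT => ?_)
  rw [card_powerset, (mem_filter.1 hT).2.1]

theorem card_filter_mem_le (c : Finset ι → G) (d : ℕ) (W : Finset ι) (v : ι) :
    #{T ∈ ({T ∈ W.powerset | #T = d ∧ c T ≠ 0} : Finset (Finset ι)) | v ∈ T} ≤
      #{S ∈ (W \ {v}).powerset | link c {v} S ≠ 0} := by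
  refine card_le_card_of_injOn (fun T => T.erase v) ?_ ?_
  · intro T hT
    obtain ⟨hT, hvT⟩ := mem_filter.1 hT
    obtain ⟨hTW, -, hTc⟩ := mem_filter.1 hT
    refine mem_filter.2 ⟨?_, ?_⟩
    · rw [mem_powerset]
      change T.erase v ⊆ W \ {v}
      rw [← sdiff_singleton_eq_erase]
      exact sdiff_subset_sdiff (mem_powerset.1 hTW) le_rfl
    · rwa [link, union_comm, ← insert_eq, insert_erase hvT]
  · intro T hT T' hT' h
    exact erase_injOn' v (mem_filter.1 hT).2 (mem_filter.1 hT').2 h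

theorem two_pow_mul_pow_le (e : ℕ) :
    2 ^ (6 * (e + 2) ^ 2) * 16 ^ (e + 1) ^ 3 ≤ 2 * 16 ^ (e + 2) ^ 3 := by
  have h1 : ∀ m, 16 ^ m = 2 ^ (4 * m) := fun m => by rw [pow_mul]; norm_num
  have h2 : 4 * (e + 2) ^ 3 + 1 =
      6 * (e + 2) ^ 2 + 4 * (e + 1) ^ 3 + (6 * e ^ 2 + 12 * e + 5) := by ring
  rw [h1, h1, ← pow_add, ← pow_succ']
  exact Nat.pow_le_pow_right two_pos (by omega)

theorem two_pow_mul_mul_le (d : ℕ) :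
    2 ^ d * (d * 2 ^ (10 * d ^ 2)) ≤ (2 ^ (6 * d ^ 2)) ^ 2 := by
  have h1 : d ≤ 2 ^ d := Nat.lt_two_pow_self.le
  refine (Nat.mul_le_mul_left _ (Nat.mul_le_mul_right _ h1)).trans ?_
  rw [← pow_add, ← pow_add, ← pow_mul]
  exact Nat.pow_le_pow_right two_pos (by nlinarith)

theorem two_pow_two_pow_le {e s : ℕ} (h : 16 ^ (e + 2) ^ 3 < √(s : ℝ)) :
    2 ^ 2 ^ (8 * (e + 2)) ≤ 2 ^ s := by
  refine Nat.pow_le_pow_right two_pos ?_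
  have h1 : (16 : ℝ) ^ (e + 2) ^ 3 ≤ s := by
    have h2 : (1 : ℝ) ≤ 16 ^ (e + 2) ^ 3 := one_le_pow₀ (by norm_num)
    calc (16 : ℝ) ^ (e + 2) ^ 3 ≤ √(s : ℝ) * 1 := by rw [mul_one]; exact h.le
      _ ≤ √(s : ℝ) * √(s : ℝ) := by gcongr; linarith
      _ = s := Real.mul_self_sqrt (Nat.cast_nonneg s)
  have h3 : 16 ^ (e + 2) ^ 3 ≤ s := by exact_mod_cast h1
  refine le_trans ?_ h3
  rw [show (16 : ℕ) = 2 ^ 4 by norm_num, ← pow_mul]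
  have h4 : 4 * (e + 2) ^ 3 = 8 * (e + 2) + (4 * e ^ 3 + 24 * e ^ 2 + 40 * e + 16) := by ring
  exact Nat.pow_le_pow_right two_pos (by omega)

theorem sub_div_sqrt_mul_two_le {e s s₁ : ℕ} (hs : 0 < s) (hs₁ : 0 < s₁)
    (h : s ≤ (2 ^ (6 * (e + 2) ^ 2)) ^ 2 * s₁) :
    ((1 / 2) ^ (e + 1) - 16 ^ (e + 2) ^ 3 / √(s : ℝ)) * 2 ≤
      (1 / 2) ^ e - 16 ^ (e + 1) ^ 3 / √(s₁ : ℝ) := by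
  have hpow := two_pow_mul_pow_le e
  generalize 2 ^ (6 * (e + 2) ^ 2) = K at h hpow
  have hpow' : (K : ℝ) * 16 ^ (e + 1) ^ 3 ≤ 2 * 16 ^ (e + 2) ^ 3 := by exact_mod_cast hpow
  have hs' : 0 < √(s : ℝ) := Real.sqrt_pos.2 (by exact_mod_cast hs)
  have hs₁' : 0 < √(s₁ : ℝ) := Real.sqrt_pos.2 (by exact_mod_cast hs₁)
  have hsqrt : √(s : ℝ) ≤ K * √(s₁ : ℝ) := by
    rw [← Real.sqrt_sq (Nat.cast_nonneg K), ← Real.sqrt_mul (by positivity)]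
    exact Real.sqrt_le_sqrt (by exact_mod_cast h)
  rw [pow_succ]
  generalize (16 : ℝ) ^ (e + 2) ^ 3 = a at hpow' ⊢
  have hb : (0 : ℝ) ≤ 16 ^ (e + 1) ^ 3 := by positivity
  generalize (16 : ℝ) ^ (e + 1) ^ 3 = b at hpow' hb ⊢
  have hloss : b / √(s₁ : ℝ) ≤ 2 * a / √(s : ℝ) := by
    rw [div_le_div_iff₀ hs₁' hs']
    calc b * √(s : ℝ) ≤ b * (K * √(s₁ : ℝ)) := by gcongr
      _ = K * b * √(s₁ : ℝ) := by ring
      _ ≤ 2 * a * √(s₁ : ℝ) := by gcongr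
  rw [mul_div_assoc] at hloss
  linarith

theorem sub_mul_le_nz (e : ℕ) {c : Finset ι → G} {s : ℕ} {W : Finset ι} (hs : 0 < s)
    (hG : NoSmallTorsion G (2 ^ s)) (hc : ∀ S ⊆ W, e + 1 < #S → c S = 0)
    (hcard : s ≤ #{S ∈ W.powerset | c S ≠ 0}) :
    ((1 / 2) ^ e - 16 ^ (e + 1) ^ 3 / √(s : ℝ)) * 2 ^ #W ≤ nz c W := by
  induction e generalizing c s W with
  | zero =>
    refine le_trans (mul_le_mul_of_nonneg_right ?_ (by positivity))
      (le_nz_of_affine hs hG hc hcard)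
    have : 1 / √(s : ℝ) ≤ 16 / √(s : ℝ) := by gcongr; norm_num
    simp only [pow_zero, zero_add, one_pow, pow_one]
    linarith
  | succ e ih =>
    have hs0 : 0 < √(s : ℝ) := Real.sqrt_pos.2 (by exact_mod_cast hs)
    have hreduce : 2 ^ #W ≤ 2 ^ (e + 1) * nz c W →
        ((1 / 2) ^ (e + 1) - 16 ^ (e + 2) ^ 3 / √(s : ℝ)) * 2 ^ #W ≤ nz c W := by
      intro h
      have h1 : (2 : ℝ) ^ #W ≤ 2 ^ (e + 1) * nz c W := by exact_mod_cast h
      have h2 : 0 ≤ 16 ^ (e + 2) ^ 3 / √(s : ℝ) * 2 ^ #W := by positivity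
      have h3 : (1 / 2 : ℝ) ^ (e + 1) * 2 ^ #W ≤ nz c W := by
        rw [one_div_pow, one_div_mul_eq_div, div_le_iff₀ (by positivity), mul_comm]
        exact h1
      linarith
    by_cases hsmall : √(s : ℝ) ≤ 16 ^ (e + 2) ^ 3
    · refine le_trans (mul_nonpos_of_nonpos_of_nonneg ?_ (by positivity)) (Nat.cast_nonneg _)
      have h1 : (1 / 2 : ℝ) ^ (e + 1) ≤ 1 := pow_le_one₀ (by norm_num) (by norm_num)
      have h2 : 1 ≤ 16 ^ (e + 2) ^ 3 / √(s : ℝ) := (one_le_div hs0).2 hsmall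
      linarith
    by_cases hmax : ∃ S ⊆ W, #S < e + 2 ∧ c S ≠ 0 ∧ ∀ T ⊆ W, S ⊂ T → c T = 0
    · obtain ⟨S, hSW, hSe, hSc, hmax⟩ := hmax
      exact hreduce ((le_nz_of_maximal hSW hSc hmax).trans
        (Nat.mul_le_mul_right _ (Nat.pow_le_pow_right two_pos (by omega))))
    push Not at hmax
    set F : Finset (Finset ι) := {T ∈ W.powerset | #T = e + 2 ∧ c T ≠ 0} with hF
    have hsF : s ≤ #F * 2 ^ (e + 2) := hcard.trans (card_le_of_not_maximal hc hmax)
    obtain ⟨M, hMF, hM, hdis⟩ | ⟨C, hC, hcov⟩ := exists_disjoint_or_cover (F := F) (r := e + 2)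
      (fun T hT => card_pos.1 (by have := (mem_filter.1 hT).2.1; omega))
      (fun T hT => (mem_filter.1 hT).2.1.le) (2 ^ (10 * (e + 2) ^ 2))
    · refine hreduce (le_nz_of_disjoint (d := e + 2) (by omega) (hG.mono ?_) hc (fun T hT => ?_)
        hdis hM.ge)
      · exact two_pow_two_pow_le (not_le.1 hsmall)
      · obtain ⟨h1, h2, h3⟩ := mem_filter.1 (hMF hT)
        exact ⟨mem_powerset.1 h1, h2, h3⟩
    · have hFne : F.Nonempty := by
        rw [nonempty_iff_ne_empty]
        intro h
        rw [h, card_empty, zero_mul] at hsF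
        omega
      obtain ⟨v, -, hv⟩ := exists_card_le_mul_of_cover hFne hcov
      set D := #{T ∈ F | v ∈ T} with hD
      have hDpos : 0 < D := Nat.pos_of_ne_zero fun h => by
        rw [h, mul_zero] at hv
        exact hFne.card_pos.ne' (Nat.le_zero.1 hv)
      have hvW : {v} ⊆ W := by
        obtain ⟨T, hT⟩ := card_pos.1 hDpos
        obtain ⟨hT, hvT⟩ := mem_filter.1 hT
        exact singleton_subset_iff.2 (mem_powerset.1 (mem_filter.1 hT).1 hvT)
      set K := 2 ^ (6 * (e + 2) ^ 2) with hK
      have hsD : s ≤ K ^ 2 * D := by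
        have := two_pow_mul_mul_le (e + 2)
        calc s ≤ #F * 2 ^ (e + 2) := hsF
          _ ≤ (#C * D) * 2 ^ (e + 2) := Nat.mul_le_mul_right _ hv
          _ ≤ ((e + 2) * 2 ^ (10 * (e + 2) ^ 2) * D) * 2 ^ (e + 2) :=
            Nat.mul_le_mul_right _ (Nat.mul_le_mul_right _ hC)
          _ = 2 ^ (e + 2) * ((e + 2) * 2 ^ (10 * (e + 2) ^ 2)) * D := by ring
          _ ≤ K ^ 2 * D := Nat.mul_le_mul_right _ this
      set s₁ := min D s with hs₁
      have hs₁0 : 0 < s₁ := lt_min hDpos hs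
      have hss₁ : s ≤ K ^ 2 * s₁ := by
        obtain h | h := min_choice D s
        · rwa [hs₁, h]
        · rw [hs₁, h]
          exact Nat.le_mul_of_pos_left _ (by positivity)
      have hIH := ih (c := link c {v}) (W := W \ {v}) hs₁0
        (hG.mono (Nat.pow_le_pow_right two_pos (min_le_right _ _)))
        (fun S hS hSe => hc _ (union_subset (hS.trans sdiff_subset) hvW) (by
          rw [card_union_of_disjoint (subset_sdiff.1 hS).2, card_singleton]
          omega))
        ((min_le_left _ _).trans (card_filter_mem_le c (e + 2) W v))
      have hWc : (2 : ℝ) ^ #W = 2 * 2 ^ #(W \ {v}) := by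
        rw [← card_sdiff_add_card_eq_card hvW, card_singleton, pow_succ']
      have hnz : (nz (link c {v}) (W \ {v}) : ℝ) ≤ nz c W := by exact_mod_cast nz_link_le c hvW
      refine le_trans ?_ (hIH.trans hnz)
      rw [hWc, ← mul_assoc]
      exact mul_le_mul_of_nonneg_right (sub_div_sqrt_mul_two_le hs hs₁0 hss₁) (by positivity)

end Main

section Cube

theorem two_pow_le_factorial_succ (s : ℕ) : 2 ^ s ≤ (s + 1).factorial := by
  induction s with
  | zero => rfl
  | succ s ih =>
    rw [Nat.factorial_succ, pow_succ, mul_comm]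
    exact Nat.mul_le_mul (by omega) ih

theorem evalPoly_eq_ev {G : Type*} [AddCommGroup G] {n : ℕ} (c : Finset (Fin n) → G)
    (x : Fin n → Bool) : evalPoly c x = ev c {i | x i = true} := by
  rw [evalPoly, ev, ← sum_filter]
  refine sum_congr ?_ fun _ _ => rfl
  ext S
  simp [subset_iff]

theorem card_evalPoly_ne_zero {G : Type*} [AddCommGroup G] {n : ℕ} (c : Finset (Fin n) → G) :
    #{x : Fin n → Bool | evalPoly c x ≠ 0} = nz c univ := by
  rw [card_filter, nz, powerset_univ]
  refine Fintype.sum_bijective (fun x : Fin n → Bool => ({i | x i = true} : Finset (Fin n)))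
    ⟨fun x y h => ?_, fun X => ⟨fun i => decide (i ∈ X), by simp⟩⟩ _ _ fun x => ?_
  · funext i
    have hi := Finset.ext_iff.1 h i
    simp only [mem_filter, mem_univ, true_and] at hi
    exact Bool.eq_iff_iff.2 hi
  · rw [evalPoly_eq_ev]

end Cube

end BoolPoly

/-- Anti-concentration for non-sparse polynomials: there is an absolute constant
`M` such that for every degree-`≤d` polynomial `Q` with at least `s` non-zero
monomials over an Abelian group whose non-zero elements all have order greater than
`(s+1)!`, we have `Pr_x[Q(x) ≠ 0] ≥ 2^{-(d-1)} − M^{d³}/√s`. -/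
theorem stmt16 :
    ∃ M : ℝ, 0 < M ∧
      ∀ (d s n : ℕ) (G : Type u) [AddCommGroup G] (Q : Finset (Fin n) → G),
        0 < d → 0 < s →
        (∀ g : G, g ≠ 0 → ∀ m : ℕ, 0 < m → m ≤ (s + 1).factorial → m • g ≠ 0) →
        (∀ S : Finset (Fin n), d < S.card → Q S = 0) →
        s ≤ (Finset.univ.filter (fun S : Finset (Fin n) => Q S ≠ 0)).card →
        ((2 : ℝ) ^ (-((d : ℤ) - 1)) - M ^ (d ^ 3) / Real.sqrt s) * 2 ^ n
          ≤ ((Finset.univ.filter (fun x : Fin n → Bool => evalPoly Q x ≠ 0)).card : ℝ) := by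
  refine ⟨16, by norm_num, fun d s n G _ Q hd hs hG hc hcard => ?_⟩
  obtain ⟨e, rfl⟩ : ∃ e, d = e + 1 := ⟨d - 1, by omega⟩
  have h := BoolPoly.sub_mul_le_nz e (W := univ) hs
    (fun g hg m hm hm' => hG g hg m hm (hm'.trans (BoolPoly.two_pow_le_factorial_succ s)))
    (fun S _ hS => hc S hS) (by simpa using hcard)
  rw [← BoolPoly.card_evalPoly_ne_zero, card_univ, Fintype.card_fin] at h
  convert h using 3
  simp [zpow_neg]
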